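/- arXiv:2208.09426 — 5 statements merged into one kernel-verified Lean document; each statement's English description precedes it below -/
import Mathlib

section
/- Let X_1, ..., X_n be i.i.d. random vectors in R^q whose distribution P satisfies P(H) = 0 for every affine hyperplane H of R^q. Then with probability one, Q̂_n({0}) = 0 and Q̂_{n,d}({0}) = 0 for all integers 1 ≤ d ≤ (n-1)/2; and if moreover n > q, then with probability one, for every linear subspace W of R^q with 1 ≤ dim(W) < q and every integer 1 ≤ d ≤ (n-1)/2, one has Q̂_n(W) < dim(W)/q and Q̂_{n,d}(W) < dim(W)/q. -/
open MeasureTheory ProbabilityTheory Finset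
open scoped ENNReal RealInnerProductSpace

noncomputable section

/-- The symmetrized Dirac measure `δ^s_z := (δ_z + δ_{-z})/2`. -/
def symmDirac {q : ℕ} (z : EuclideanSpace ℝ (Fin q)) : Measure (EuclideanSpace ℝ (Fin q)) :=
  (2 : ℝ≥0∞)⁻¹ • (Measure.dirac z + Measure.dirac (-z))

/-- The complete symmetrized empirical measure
`Q̂_n := binom(n,2)⁻¹ ∑_{1 ≤ i < j ≤ n} δ^s_{X_j - X_i}` (indices here `0,...,n-1`). -/
def Qhat {Ω : Type*} {q : ℕ} (n : ℕ) (X : ℕ → Ω → EuclideanSpace ℝ (Fin q)) (ω : Ω) :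
    Measure (EuclideanSpace ℝ (Fin q)) :=
  ((n.choose 2 : ℕ) : ℝ≥0∞)⁻¹ •
    ∑ p ∈ (range n ×ˢ range n).filter fun p => p.1 < p.2,
      symmDirac (X p.2 ω - X p.1 ω)

/-- The balanced incomplete symmetrized empirical measure
`Q̂_{n,d} := (nd)⁻¹ ∑_{i=1}^n ∑_{j=i+1}^{i+d} δ^s_{X_j - X_i}` with cyclic indexing. -/
def Qhatd {Ω : Type*} {q : ℕ} (n d : ℕ) (X : ℕ → Ω → EuclideanSpace ℝ (Fin q)) (ω : Ω) :
    Measure (EuclideanSpace ℝ (Fin q)) :=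
  ((n * d : ℕ) : ℝ≥0∞)⁻¹ •
    ∑ p ∈ range n ×ˢ Icc 1 d, symmDirac (X ((p.1 + p.2) % n) ω - X p.1 ω)


/-- edge cut of a circulant graph -/
lemma circ_bound {n d : ℕ} [NeZero n] (hd : 1 ≤ d) (hdn : 2 * d ≤ n - 1)
    (S : Finset (ZMod n)) (hS : S.Nonempty) (hS' : S.card < n) :
    (((univ : Finset (ZMod n)) ×ˢ Icc 1 d).filter
      (fun p => p.1 ∈ S ∧ p.1 + (p.2 : ZMod n) ∈ S)).card ≤ (S.card - 1) * d := by
  classical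
  have hn : 3 ≤ n := by omega
  have hcast : ∀ a b : ℕ, a < n → b < n → (a : ZMod n) = (b : ZMod n) → a = b := by
    intro a b ha hb h
    have := congrArg ZMod.val h
    rwa [ZMod.val_natCast, ZMod.val_natCast, Nat.mod_eq_of_lt ha, Nat.mod_eq_of_lt hb] at this
  set U := (univ : Finset (ZMod n)) ×ˢ Icc 1 d with hU
  set e := U.filter (fun p => p.1 ∈ S ∧ p.1 + (p.2 : ZMod n) ∈ S) with he
  set o := U.filter (fun p => p.1 ∈ S ∧ p.1 + (p.2 : ZMod n) ∉ S) with ho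
  set o' := U.filter (fun p => p.1 ∉ S ∧ p.1 + (p.2 : ZMod n) ∈ S) with ho'
  have h1 : e.card + o.card = S.card * d := by
    have : (S ×ˢ Icc 1 d).card = S.card * d := by simp
    rw [← this, ← card_union_of_disjoint]
    · congr 1
      ext ⟨a, b⟩
      simp only [he, ho, hU, mem_union, mem_filter, mem_product, mem_univ]
      tauto
    · rw [disjoint_left]
      simp only [he, ho, mem_filter]
      tauto
  have h2 : e.card + o'.card = S.card * d := by
    have : (S ×ˢ Icc 1 d).card = S.card * d := by simp
    rw [← this, ← card_union_of_disjoint]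
    · refine card_nbij' (fun p => (p.1 + (p.2 : ZMod n), p.2)) (fun p => (p.1 - (p.2 : ZMod n), p.2)) ?_ ?_ ?_ ?_
      · rintro ⟨a, b⟩
        simp only [he, ho', hU, coe_union, coe_filter, coe_product, Set.mem_union, Set.mem_ofPred_eq, mem_product, Set.mem_prod, mem_coe]
        tauto
      · rintro ⟨a, b⟩
        simp only [he, ho', hU, coe_union, coe_filter, coe_product, Set.mem_union, Set.mem_ofPred_eq, mem_product, Set.mem_prod, mem_coe, sub_add_cancel, mem_univ]
        tauto
      · rintro ⟨a, b⟩ _; simp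
      · rintro ⟨a, b⟩ _; simp
    · rw [disjoint_left]
      simp only [he, ho', mem_filter]
      tauto
  obtain ⟨i, hi, hi1⟩ : ∃ i, i ∈ S ∧ i + 1 ∉ S := by
    by_contra! hcon
    obtain ⟨z, hz⟩ := hS
    have key : ∀ k : ℕ, z + (k : ZMod n) ∈ S := by
      intro k
      induction k with
      | zero => simpa using hz
      | succ k ih => have := hcon _ ih; push_cast; rwa [← add_assoc]
    have : S = univ := by
      ext w
      simp only [mem_univ, iff_true]
      have := key (w - z).val
      rwa [ZMod.natCast_zmod_val, add_sub_cancel] at this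
    rw [this, card_univ, ZMod.card] at hS'
    omega
  let f1 : ℕ → ZMod n × ℕ := fun t => if i + (t : ZMod n) ∈ S then (i + 1, t - 1) else (i, t)
  let f2 : ℕ → ZMod n × ℕ := fun t => if i - (t : ZMod n) ∈ S then (i - (t : ZMod n), t + 1) else (i - (t : ZMod n), t)
  have hii : i ≠ i + 1 := by
    intro h
    have := hcast 0 1 (by omega) (by omega) (by
      have : i + 0 = i + 1 := by simpa using h
      simpa using add_left_cancel this)
    omega
  have hinj1 : Set.InjOn f1 (Icc 1 d : Finset ℕ) := by
    intro a ha b hb hab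
    simp only [coe_Icc, Set.mem_Icc] at ha hb
    simp only [f1] at hab
    split_ifs at hab with h h' h' <;> simp only [Prod.mk.injEq] at hab
    · omega
    · exact absurd hab.1.symm hii
    · exact absurd hab.1 hii
    · omega
  have hfst2 : ∀ t, (f2 t).1 = i - (t : ZMod n) := by
    intro t; simp only [f2]; split_ifs <;> rfl
  have hinj2 : Set.InjOn f2 (Icc 1 (d - 1) : Finset ℕ) := by
    intro a ha b hb hab
    simp only [coe_Icc, Set.mem_Icc] at ha hb
    have := congrArg Prod.fst hab
    rw [hfst2, hfst2] at this
    exact hcast a b (by omega) (by omega) (sub_right_injective this)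
  have hsub1 : (Icc 1 d).image f1 ⊆ o ∪ o' := by
    intro x hx
    obtain ⟨t, ht, rfl⟩ := mem_image.1 hx
    rw [mem_Icc] at ht
    simp only [f1]
    split_ifs with h
    · have ht1 : t ≠ 1 := by rintro rfl; exact hi1 (by simpa using h)
      simp only [ho, ho', hU, mem_union, mem_filter, mem_product, mem_univ, mem_Icc]
      right
      refine ⟨⟨trivial, by omega, by omega⟩, hi1, ?_⟩
      rw [Nat.cast_sub ht.1]
      simpa using h
    · simp only [ho, ho', hU, mem_union, mem_filter, mem_product, mem_univ, mem_Icc]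
      left; exact ⟨⟨trivial, ht⟩, hi, h⟩
  have hsub2 : (Icc 1 (d-1)).image f2 ⊆ o ∪ o' := by
    intro x hx
    obtain ⟨t, ht, rfl⟩ := mem_image.1 hx
    rw [mem_Icc] at ht
    simp only [f2]
    split_ifs with h
    · simp only [ho, ho', hU, mem_union, mem_filter, mem_product, mem_univ, mem_Icc]
      left; refine ⟨⟨trivial, by omega, by omega⟩, h, ?_⟩
      push_cast
      rwa [← add_assoc, sub_add_cancel]
    · simp only [ho, ho', hU, mem_union, mem_filter, mem_product, mem_univ, mem_Icc]
      right; refine ⟨⟨trivial, by omega, by omega⟩, h, ?_⟩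
      rwa [sub_add_cancel]
  have hdisj : Disjoint ((Icc 1 d).image f1) ((Icc 1 (d-1)).image f2) := by
    rw [disjoint_left]
    intro x hx hx'
    obtain ⟨t, ht, rfl⟩ := mem_image.1 hx
    obtain ⟨s, hs, hst⟩ := mem_image.1 hx'
    rw [mem_Icc] at ht hs
    have h := congrArg Prod.fst hst
    rw [hfst2] at h
    simp only [f1] at h
    split_ifs at h
    · have h0 : ((s + 1 : ℕ) : ZMod n) = ((0 : ℕ) : ZMod n) := by
        push_cast
        linear_combination -h
      have := hcast (s+1) 0 (by omega) (by omega) h0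
      omega
    · have h0 : ((s : ℕ) : ZMod n) = ((0 : ℕ) : ZMod n) := by
        simpa using h
      have := hcast s 0 (by omega) (by omega) h0
      omega
  have h3 : d + (d - 1) ≤ o.card + o'.card := by
    calc d + (d - 1) = ((Icc 1 d).image f1 ∪ (Icc 1 (d-1)).image f2).card := by
          rw [card_union_of_disjoint hdisj, card_image_of_injOn hinj1, card_image_of_injOn hinj2]
          simp
      _ ≤ (o ∪ o').card := card_le_card (union_subset hsub1 hsub2)
      _ ≤ _ := card_union_le _ _
  have h4 : 1 ≤ S.card := hS.card_pos
  rw [Nat.sub_mul]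
  omega

lemma sum_fib {β : Type*} [DecidableEq β] {ι : Type*} [DecidableEq ι] (A : Finset ι) (c : ι → β) :
    (∑ b ∈ A.image c, ((A.filter (fun i => c i = b)).card - 1)) + (A.image c).card = A.card := by
  rw [card_eq_sum_card_image c A, card_eq_sum_ones, ← sum_add_distrib]
  refine sum_congr rfl fun b hb => ?_
  obtain ⟨i, hi, rfl⟩ := mem_image.1 hb
  have : 0 < (A.filter (fun j => c j = c i)).card := card_pos.2 ⟨i, by simp [hi]⟩
  omega

lemma circ_count {β : Type*} [DecidableEq β] {n d k : ℕ} (hd : 1 ≤ d) (hdn : 2 * d ≤ n - 1)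
    (c : ℕ → β) (hk : k + 1 < n) (hc : n ≤ ((range n).image c).card + k) :
    ((range n ×ˢ Icc 1 d).filter (fun p => c ((p.1 + p.2) % n) = c p.1)).card ≤ k * d := by
  have : NeZero n := ⟨by omega⟩
  let C : ZMod n → β := fun z => c z.val
  have hC : ∀ m : ℕ, C (m : ZMod n) = c (m % n) := fun m => by simp [C, ZMod.val_natCast]
  have himg : (univ : Finset (ZMod n)).image C = (range n).image c := by
    ext b
    simp only [mem_image, mem_univ, true_and, mem_range]
    constructor
    · rintro ⟨z, rfl⟩; exact ⟨z.val, ZMod.val_lt z, rfl⟩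
    · rintro ⟨i, hi, rfl⟩; exact ⟨i, by rw [hC, Nat.mod_eq_of_lt hi]⟩
  have hs := sum_fib (univ : Finset (ZMod n)) C
  rw [himg, card_univ, ZMod.card] at hs
  have e1 : ((range n ×ˢ Icc 1 d).filter (fun p => c ((p.1 + p.2) % n) = c p.1)).card =
      (((univ : Finset (ZMod n)) ×ˢ Icc 1 d).filter (fun p => C (p.1 + (p.2 : ZMod n)) = C p.1)).card := by
    refine card_nbij' (fun p => ((p.1 : ZMod n), p.2)) (fun p => (p.1.val, p.2)) ?_ ?_ ?_ ?_
    · rintro ⟨a, b⟩ h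
      simp only [coe_filter, mem_product, mem_range, mem_Icc, Set.mem_ofPred_eq, mem_univ] at h ⊢
      rw [← Nat.cast_add, hC, hC, Nat.mod_eq_of_lt h.1.1]
      exact ⟨⟨trivial, h.1.2⟩, h.2⟩
    · rintro ⟨a, b⟩ h
      simp only [coe_filter, mem_product, mem_range, mem_Icc, Set.mem_ofPred_eq, mem_univ] at h ⊢
      refine ⟨⟨ZMod.val_lt a, h.1.2⟩, ?_⟩
      rw [← hC]
      push_cast
      rw [ZMod.natCast_zmod_val]
      exact h.2
    · rintro ⟨a, b⟩ h
      simp only [coe_filter, mem_product, mem_range, mem_Icc, Set.mem_ofPred_eq, mem_univ] at h ⊢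
      rw [ZMod.val_natCast, Nat.mod_eq_of_lt h.1.1]
    · rintro ⟨a, b⟩ h
      simp
  rw [e1]
  have hmap : ∀ p ∈ (((univ : Finset (ZMod n)) ×ˢ Icc 1 d).filter (fun p => C (p.1 + (p.2 : ZMod n)) = C p.1)),
      C p.1 ∈ (range n).image c := by
    intro p _; rw [← himg]; exact mem_image_of_mem _ (mem_univ _)
  rw [card_eq_sum_card_fiberwise hmap]
  have : ∀ b ∈ (range n).image c, ((((univ : Finset (ZMod n)) ×ˢ Icc 1 d).filter (fun p => C (p.1 + (p.2 : ZMod n)) = C p.1)).filter (fun p => C p.1 = b)).card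
      ≤ ((univ.filter (fun z => C z = b)).card - 1) * d := by
    intro b hb
    have hle := single_le_sum (f := fun b => (univ.filter (fun z => C z = b)).card - 1) (fun _ _ => Nat.zero_le _) hb
    refine le_trans (le_of_eq ?_) (circ_bound hd hdn (univ.filter (fun z => C z = b)) ?_ ?_)
    · congr 1
      ext p
      simp only [mem_filter, mem_univ, true_and]
      constructor
      · rintro ⟨⟨h, h1⟩, h2⟩; exact ⟨h, h2, h1.trans h2⟩
      · rintro ⟨h, h1, h2⟩; exact ⟨⟨h, h2.trans h1.symm⟩, h1⟩
    · rw [← himg] at hb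
      obtain ⟨z, _, hz⟩ := mem_image.1 hb
      exact ⟨z, by simp [hz]⟩
    · omega
  refine (sum_le_sum this).trans ?_
  rw [← sum_mul]
  exact Nat.mul_le_mul_right _ (by omega)

lemma pair_count {β : Type*} [DecidableEq β] {n k : ℕ}
    (c : ℕ → β) (hc : n ≤ ((range n).image c).card + k) :
    ((((range n ×ˢ range n).filter fun p => p.1 < p.2)).filter (fun p => c p.2 = c p.1)).card * 2
      ≤ (k + 1) * k := by
  have hs := sum_fib (range n) c
  rw [card_range] at hs
  have hmap : ∀ p ∈ ((((range n ×ˢ range n).filter fun p => p.1 < p.2)).filter (fun p => c p.2 = c p.1)),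
      c p.1 ∈ (range n).image c := by
    intro p hp
    simp only [mem_filter, mem_product] at hp
    exact mem_image_of_mem _ hp.1.1.1
  rw [card_eq_sum_card_fiberwise hmap, sum_mul]
  have : ∀ b ∈ (range n).image c, (((((range n ×ˢ range n).filter fun p => p.1 < p.2)).filter (fun p => c p.2 = c p.1)).filter (fun p => c p.1 = b)).card * 2
      ≤ (k + 1) * (((range n).filter (fun z => c z = b)).card - 1) := by
    intro b hb
    have hle := single_le_sum (f := fun b => ((range n).filter (fun z => c z = b)).card - 1) (fun _ _ => Nat.zero_le _) hb
    set S := (range n).filter (fun z => c z = b) with hS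
    set F := (((((range n ×ˢ range n).filter fun p => p.1 < p.2)).filter (fun p => c p.2 = c p.1)).filter (fun p => c p.1 = b)) with hF
    have h1 : F.card * 2 ≤ S.offDiag.card := by
      have hsw : (F.image Prod.swap).card = F.card := card_image_of_injective _ Prod.swap_injective
      have : F ∪ F.image Prod.swap ⊆ S.offDiag := by
        rintro ⟨x, y⟩ hx
        rw [mem_union, mem_image] at hx
        simp only [mem_offDiag, hS, mem_filter]
        rcases hx with hx | ⟨⟨u, v⟩, hx, hxy⟩
        · simp only [hF, mem_filter, mem_product] at hx
          obtain ⟨⟨⟨⟨h1, h2⟩, h3⟩, h4⟩, h5⟩ := hx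
          exact ⟨⟨h1, h5⟩, ⟨h2, h4.trans h5⟩, h3.ne⟩
        · simp only [hF, mem_filter, mem_product] at hx
          obtain ⟨⟨⟨⟨h1, h2⟩, h3⟩, h4⟩, h5⟩ := hx
          simp only [Prod.swap_prod_mk, Prod.mk.injEq] at hxy
          obtain ⟨rfl, rfl⟩ := hxy
          exact ⟨⟨h2, h4.trans h5⟩, ⟨h1, h5⟩, h3.ne'⟩
      have hdisj : Disjoint F (F.image Prod.swap) := by
        rw [disjoint_left]
        rintro ⟨x, y⟩ h h'
        obtain ⟨⟨u, v⟩, hx, hxy⟩ := mem_image.1 h'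
        simp only [hF, mem_filter, mem_product] at h hx
        simp only [Prod.swap_prod_mk, Prod.mk.injEq] at hxy
        omega
      have := card_le_card this
      rw [card_union_of_disjoint hdisj, hsw] at this
      omega
    rw [offDiag_card] at h1
    refine h1.trans ?_
    rw [← Nat.mul_sub_one]
    exact Nat.mul_le_mul_right _ (by omega)
  refine (sum_le_sum this).trans ?_
  rw [← mul_sum]
  exact Nat.mul_le_mul_left _ (by omega)

lemma null_of_sections {Ω α β : Type*} [MeasurableSpace Ω] [MeasurableSpace α] [MeasurableSpace β]
    (P : Measure Ω) [IsProbabilityMeasure P] {U : Ω → α} {V : Ω → β} (hU : Measurable U)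
    (hV : Measurable V) (h : IndepFun V U P) {B : Set (β × α)} (hB : MeasurableSet B)
    (hs : ∀ v, Measure.map U P {u | (v, u) ∈ B} = 0) : ∀ᵐ ω ∂P, (V ω, U ω) ∉ B := by
  have h1 := (indepFun_iff_map_prod_eq_prod_map_map hV.aemeasurable hU.aemeasurable).1 h
  have : IsProbabilityMeasure (Measure.map U P) := Measure.isProbabilityMeasure_map hU.aemeasurable
  have h2 : ((Measure.map V P).prod (Measure.map U P)) B = 0 := by
    rw [Measure.measure_prod_null hB]
    exact Filter.Eventually.of_forall hs
  rw [← h1, Measure.map_apply (hV.prodMk hU) hB] at h2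
  exact measure_eq_zero_iff_ae_notMem.1 h2

lemma isOpen_li {q : ℕ} {Z : Type*} [TopologicalSpace Z] (T : Finset ℕ)
    (g : Z → ℕ → EuclideanSpace ℝ (Fin q)) (hg : ∀ i, Continuous fun z => g z i) :
    IsOpen {z | LinearIndepOn ℝ (g z) (T : Set ℕ)} := by
  have := (isOpen_setOfPred_linearIndependent (𝕜 := ℝ) (E := EuclideanSpace ℝ (Fin q)) (ι := (T : Set ℕ)))
  exact this.preimage (f := fun z (i : (T : Set ℕ)) => g z i) (continuous_pi fun i => hg i)

lemma gen_pos {q : ℕ} {Ω : Type*} [MeasurableSpace Ω] (P : Measure Ω) [IsProbabilityMeasure P]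
    (X : ℕ → Ω → EuclideanSpace ℝ (Fin q)) (hXm : ∀ i, Measurable (X i))
    (hindep : iIndepFun X P)
    (hident : ∀ i, Measure.map (X i) P = Measure.map (X 0) P)
    (hplane : ∀ (v : EuclideanSpace ℝ (Fin q)) (c : ℝ), v ≠ 0 →
      Measure.map (X 0) P {x | ⟪v, x⟫ = c} = 0) (f : ℕ → ℕ) (T : Finset ℕ)
    (hf : ∀ i ∈ T, f i < i) (hT : T.card ≤ q) :
    ∀ᵐ ω ∂P, LinearIndepOn ℝ (fun i => X i ω - X (f i) ω) (T : Set ℕ) := by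
  classical
  induction T using Finset.induction_on_max with
  | empty => simp
  | insert a T hmax ih =>
    have haT : a ∉ T := fun h => lt_irrefl _ (hmax a h)
    rw [card_insert_of_notMem haT] at hT
    have ih := ih (fun i hi => hf i (mem_insert_of_mem hi)) (by omega)
    let E := EuclideanSpace ℝ (Fin q)
    let V : Ω → (range a → E) := fun ω i => X i ω
    have hV : Measurable V := measurable_pi_lambda _ fun i => hXm i
    have hind : IndepFun V (X a) P := by
      have := iIndepFun.indepFun_finset (range a) {a} (by simp) hindep hXm
      exact this.comp (φ := id) (ψ := fun (u : ({a} : Finset ℕ) → E) => u ⟨a, by simp⟩) measurable_id (measurable_pi_apply _)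
    let ext : (range a → E) → ℕ → E := fun y i => if h : i ∈ range a then y ⟨i, h⟩ else 0
    have hext : ∀ i, Continuous fun y => ext y i := by
      intro i
      simp only [ext]
      split_ifs
      · exact continuous_apply _
      · exact continuous_const
    let g : ((range a → E) × E) → ℕ → E := fun z i =>
      (if i = a then z.2 else ext z.1 i) - ext z.1 (f i)
    have hg : ∀ i, Continuous fun z => g z i := by
      intro i
      simp only [g]
      refine Continuous.sub ?_ ((hext _).comp continuous_fst)
      split_ifs
      · exact continuous_snd
      · exact (hext _).comp continuous_fst
    let B : Set ((range a → E) × E) := {z | LinearIndepOn ℝ (g z) (T : Set ℕ)} \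
      {z | LinearIndepOn ℝ (g z) ((insert a T : Finset ℕ) : Set ℕ)}
    have hB : MeasurableSet B := (isOpen_li T g hg).measurableSet.diff (isOpen_li _ g hg).measurableSet
    have hgX : ∀ ω, ∀ i ∈ insert a T, g (V ω, X a ω) i = X i ω - X (f i) ω := by
      intro ω i hi
      have hfi := hf i hi
      have h2 : i ≤ a := by
        rcases mem_insert.1 hi with rfl | h
        · rfl
        · exact (hmax i h).le
      simp only [g, ext, V, mem_range]
      have h5 : f i < a := by omega
      rw [dif_pos h5]
      congr 1
      by_cases h3 : i = a
      · rw [if_pos h3, h3]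
      · have h6 : i < a := by omega
        rw [if_neg h3, dif_pos h6]
    have key := null_of_sections P (hXm a) hV hind hB (by
      intro y
      by_cases hy : ∃ u, (y, u) ∈ B
      swap
      · push Not at hy
        simp [hy]
      let K := Submodule.span ℝ ((fun i => ext y i - ext y (f i)) '' (T : Set ℕ))
      have hK : Kᗮ ≠ ⊥ := by
        intro h
        rw [Submodule.orthogonal_eq_bot_iff] at h
        have h1 : Module.finrank ℝ K ≤ T.card := by
          have := finrank_span_finset_le_card (R := ℝ) (T.image (fun i => ext y i - ext y (f i)))
          rw [coe_image] at this
          exact this.trans card_image_le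
        rw [h, finrank_top, finrank_euclideanSpace_fin] at h1
        omega
      obtain ⟨v, hv, hv0⟩ := Submodule.exists_mem_ne_zero_of_ne_bot hK
      rw [hident a]
      refine measure_mono_null ?_ (hplane v ⟪v, ext y (f a)⟫ hv0)
      rintro u ⟨hu1, hu2⟩
      simp only [Set.mem_ofPred_eq] at hu1 hu2 ⊢
      rw [coe_insert, linearIndepOn_insert (by simpa using haT)] at hu2
      have hu3 : g (y, u) a ∈ Submodule.span ℝ (g (y, u) '' (T : Set ℕ)) := by tauto
      have himg : g (y, u) '' (T : Set ℕ) = (fun i => ext y i - ext y (f i)) '' (T : Set ℕ) := by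
        refine Set.image_congr fun i hi => ?_
        have : i ≠ a := (hmax i hi).ne
        simp [g, this]
      rw [himg] at hu3
      have h0 := (Submodule.mem_orthogonal' K v).1 hv _ hu3
      simp only [g, if_true, inner_sub_right] at h0
      linarith)
    filter_upwards [ih, key] with ω h1 h2
    have h3 : LinearIndepOn ℝ (g (V ω, X a ω)) (T : Set ℕ) :=
      (linearIndepOn_congr fun i hi => hgX ω i (mem_insert_of_mem hi)).2 h1
    have h4 : LinearIndepOn ℝ (g (V ω, X a ω)) ((insert a T : Finset ℕ) : Set ℕ) := by
      by_contra h4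
      exact h2 ⟨h3, h4⟩
    exact (linearIndepOn_congr fun i hi => hgX ω i hi).1 h4

lemma classes_bound {q n : ℕ} (x : ℕ → EuclideanSpace ℝ (Fin q))
    (hx : ∀ f : Fin n → Fin n, ∀ T ∈ (range n).powerset,
      (∀ i ∈ T, (if h : i < n then (f ⟨i, h⟩ : ℕ) else 0) < i) → T.card ≤ q →
      LinearIndepOn ℝ (fun i => x i - x (if h : i < n then (f ⟨i, h⟩ : ℕ) else 0)) (T : Set ℕ))
    (W : Submodule ℝ (EuclideanSpace ℝ (Fin q))) (hW : Module.finrank ℝ W < q)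
    [DecidableEq (EuclideanSpace ℝ (Fin q) ⧸ W)] :
    n ≤ ((range n).image (fun i => W.mkQ (x i))).card + Module.finrank ℝ W := by
  classical
  by_contra! hcon
  set c := fun i => W.mkQ (x i) with hc
  have hex : ∀ i, ∃ j, c j = c i := fun i => ⟨i, rfl⟩
  let r : ℕ → ℕ := fun i => Nat.find (hex i)
  have hr : ∀ i, c (r i) = c i := fun i => Nat.find_spec (hex i)
  have hri : ∀ i, r i ≤ i := fun i => Nat.find_min' (hex i) rfl
  let T := (range n).filter (fun i => r i < i)
  have hTc : ((range n).filter (fun i => ¬ r i < i)).card ≤ ((range n).image c).card := by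
    refine card_le_card_of_injOn c ?_ ?_
    · intro i hi
      simp only [coe_filter, Set.mem_ofPred_eq] at hi
      exact mem_coe.2 (mem_image_of_mem _ hi.1)
    · intro i hi j hj hij
      simp only [coe_filter, Set.mem_ofPred_eq] at hi hj
      have h1 := hri i
      have h2 := hri j
      have : r i = r j := by simp only [r, hij]
      omega
  have hcard := card_filter_add_card_filter_not (s := range n) (fun i => r i < i)
  rw [card_range] at hcard
  obtain ⟨T', hT', hT'c⟩ := exists_subset_card_eq (s := T) (n := Module.finrank ℝ W + 1) (by
    simp only [T]; omega)
  have hT'n : ∀ i ∈ T', i < n ∧ r i < i := fun i hi => by simpa [T] using hT' hi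
  let f : Fin n → Fin n := fun i => ⟨r i, (hri i).trans_lt i.2⟩
  have hff : ∀ i ∈ T', (if h : i < n then (f ⟨i, h⟩ : ℕ) else 0) = r i := by
    intro i hi; rw [dif_pos (hT'n i hi).1]
  have hli := hx f T' (by
    rw [mem_powerset]; intro i hi; exact mem_range.2 (hT'n i hi).1) (by
    intro i hi; rw [hff i hi]; exact (hT'n i hi).2) (by omega)
  have hmem : ∀ i : (T' : Set ℕ), x i - x (if h : (i : ℕ) < n then (f ⟨i, h⟩ : ℕ) else 0) ∈ W := by
    intro i
    rw [hff i i.2, ← Submodule.Quotient.eq]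
    exact (hr i).symm
  have hli2 : LinearIndependent ℝ (fun i : (T' : Set ℕ) => (⟨_, hmem i⟩ : W)) :=
    LinearIndependent.of_comp W.subtype hli
  have := hli2.fintype_card_le_finrank
  simp at this
  omega

lemma symmDirac_apply {q : ℕ} (z : EuclideanSpace ℝ (Fin q)) (A : Submodule ℝ (EuclideanSpace ℝ (Fin q)))
    [Decidable (z ∈ A)] :
    symmDirac z (A : Set (EuclideanSpace ℝ (Fin q))) = if z ∈ A then 1 else 0 := by
  have hA : MeasurableSet (A : Set (EuclideanSpace ℝ (Fin q))) :=
    (Submodule.closed_of_finiteDimensional A).measurableSet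
  rw [symmDirac, Measure.smul_apply, Measure.add_apply, Measure.dirac_apply' _ hA,
    Measure.dirac_apply' _ hA]
  by_cases h : z ∈ A
  · have h' : -z ∈ A := A.neg_mem h
    simp [h, h', one_add_one_eq_two, ENNReal.inv_mul_cancel]
  · have h' : -z ∉ A := fun h' => h (by simpa using A.neg_mem h')
    simp [h]

lemma Q_sum {q : ℕ} (M : ℕ) (F : Finset (ℕ × ℕ)) (z : ℕ × ℕ → EuclideanSpace ℝ (Fin q))
    (A : Submodule ℝ (EuclideanSpace ℝ (Fin q))) [∀ z, Decidable (z ∈ A)] :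
    (((M : ℕ) : ℝ≥0∞)⁻¹ • ∑ p ∈ F, symmDirac (z p)) (A : Set (EuclideanSpace ℝ (Fin q))) =
      ((F.filter (fun p => z p ∈ A)).card : ℝ≥0∞) / (M : ℝ≥0∞) := by
  rw [Measure.smul_apply, Measure.finsetSum_apply, ENNReal.div_eq_inv_mul, smul_eq_mul]
  congr 1
  simp only [symmDirac_apply]
  simp

lemma div_lt_aux {N M k q : ℕ} (hM : 0 < M) (hq : 0 < q) (h : N * q < k * M) :
    (N : ℝ≥0∞) / (M : ℝ≥0∞) < (k : ℝ≥0∞) / (q : ℝ≥0∞) := by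
  have hM' : (M : ℝ≥0∞) ≠ 0 := by exact_mod_cast hM.ne'
  have hq' : (q : ℝ≥0∞) ≠ 0 := by exact_mod_cast hq.ne'
  rw [ENNReal.div_lt_iff (Or.inl hM') (Or.inl (ENNReal.natCast_ne_top _)), mul_comm, ← mul_div_assoc,
    ENNReal.lt_div_iff_mul_lt (Or.inl hq') (Or.inl (ENNReal.natCast_ne_top _))]
  rw [mul_comm k M] at h
  exact_mod_cast h

/-- Proposition 1. -/
theorem stmt0 {q n : ℕ} (hq : 1 ≤ q) (hn : 2 ≤ n)
    {Ω : Type*} [MeasurableSpace Ω] (P : Measure Ω) [IsProbabilityMeasure P]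
    (X : ℕ → Ω → EuclideanSpace ℝ (Fin q)) (hXm : ∀ i, Measurable (X i))
    (hindep : iIndepFun X P)
    (hident : ∀ i, Measure.map (X i) P = Measure.map (X 0) P)
    (hplane : ∀ (v : EuclideanSpace ℝ (Fin q)) (c : ℝ), v ≠ 0 →
      Measure.map (X 0) P {x | ⟪v, x⟫ = c} = 0) :
    (∀ᵐ ω ∂P, Qhat n X ω {0} = 0 ∧
      ∀ d : ℕ, 1 ≤ d → 2 * d ≤ n - 1 → Qhatd n d X ω {0} = 0) ∧
    (q < n → ∀ᵐ ω ∂P, ∀ W : Submodule ℝ (EuclideanSpace ℝ (Fin q)),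
      1 ≤ Module.finrank ℝ W → Module.finrank ℝ W < q →
        Qhat n X ω (W : Set (EuclideanSpace ℝ (Fin q))) <
            (Module.finrank ℝ W : ℝ≥0∞) / (q : ℝ≥0∞) ∧
        ∀ d : ℕ, 1 ≤ d → 2 * d ≤ n - 1 →
          Qhatd n d X ω (W : Set (EuclideanSpace ℝ (Fin q))) <
            (Module.finrank ℝ W : ℝ≥0∞) / (q : ℝ≥0∞)) := by
  classical
  have hgp := gen_pos P X hXm hindep hident hplane
  constructor
  · have hne : ∀ᵐ ω ∂P, ∀ i j : ℕ, i < j → X j ω - X i ω ≠ 0 := by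
      rw [ae_all_iff]; intro i
      rw [ae_all_iff]; intro j
      by_cases hij : i < j
      · filter_upwards [hgp (fun _ => i) {j} (by simpa using hij) (by simpa using hq)] with ω h _
        exact h.ne_zero (i := j) (by simp)
      · exact Filter.Eventually.of_forall fun ω h => absurd h hij
    filter_upwards [hne] with ω h
    have hne' : ∀ i j : ℕ, i ≠ j → X j ω - X i ω ≠ 0 := by
      intro i j hij
      rcases lt_or_gt_of_ne hij with h1 | h1
      · exact h i j h1
      · rw [← neg_sub]; exact neg_ne_zero.2 (h j i h1)
    have hbot : ({0} : Set (EuclideanSpace ℝ (Fin q))) =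
      ((⊥ : Submodule ℝ (EuclideanSpace ℝ (Fin q))) : Set (EuclideanSpace ℝ (Fin q))) := by simp
    rw [hbot]
    refine ⟨?_, ?_⟩
    · rw [Qhat, Q_sum _ _ (fun p => X p.2 ω - X p.1 ω), filter_eq_empty_iff.2]
      · simp
      · intro p hp
        simp only [mem_filter] at hp
        rw [Submodule.mem_bot]
        exact hne' _ _ hp.2.ne
    · intro d hd hdn
      rw [Qhatd, Q_sum _ _ (fun p => X ((p.1 + p.2) % n) ω - X p.1 ω), filter_eq_empty_iff.2]
      · simp
      · rintro ⟨i, s⟩ hp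
        simp only [mem_product, mem_range, mem_Icc] at hp
        rw [Submodule.mem_bot]
        refine hne' _ _ ?_
        simp only
        intro heq
        rcases lt_or_ge (i + s) n with h1 | h1
        · rw [Nat.mod_eq_of_lt h1] at heq; omega
        · rw [Nat.mod_eq_sub_mod h1, Nat.mod_eq_of_lt (by omega)] at heq; omega
  · intro hqn
    have hall : ∀ᵐ ω ∂P, ∀ f : Fin n → Fin n, ∀ T ∈ (range n).powerset,
      (∀ i ∈ T, (if h : i < n then (f ⟨i, h⟩ : ℕ) else 0) < i) → T.card ≤ q →
      LinearIndepOn ℝ (fun i => X i ω - X (if h : i < n then (f ⟨i, h⟩ : ℕ) else 0) ω) (T : Set ℕ) := by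
      rw [ae_all_iff]; intro f
      rw [ae_all_iff]; intro T
      by_cases hT : (∀ i ∈ T, (if h : i < n then (f ⟨i, h⟩ : ℕ) else 0) < i) ∧ T.card ≤ q
      · filter_upwards [hgp (fun i => if h : i < n then (f ⟨i, h⟩ : ℕ) else 0) T hT.1 hT.2] with ω h _ _ _
        exact h
      · exact Filter.Eventually.of_forall fun ω _ h1 h2 => absurd ⟨h1, h2⟩ hT
    filter_upwards [hall] with ω hω W hW1 hWq
    have hcl := classes_bound (fun i => X i ω) hω W hWq
    have hiff : ∀ i j : ℕ, X j ω - X i ω ∈ W ↔ W.mkQ (X j ω) = W.mkQ (X i ω) := fun i j =>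
      (Submodule.Quotient.eq W).symm
    refine ⟨?_, ?_⟩
    · rw [Qhat, Q_sum _ _ (fun p => X p.2 ω - X p.1 ω)]
      refine div_lt_aux (Nat.choose_pos hn) hq ?_
      have h1 := pair_count _ hcl
      simp only [hiff]
      have h2 : n.choose 2 * 2 = n * (n - 1) := by
        rw [Nat.choose_two_right]
        exact Nat.div_mul_cancel (Nat.even_mul_pred_self n).two_dvd
      set N := card _
      set k := Module.finrank ℝ W
      have h3 : (k + 1) * q < n * (n - 1) :=
        calc (k + 1) * q ≤ (n - 1) * (n - 1) := Nat.mul_le_mul (by omega) (by omega)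
          _ < n * (n - 1) := Nat.mul_lt_mul_of_pos_right (by omega) (by omega)
      have h4 : N * 2 * q ≤ (k + 1) * k * q := Nat.mul_le_mul_right _ h1
      have h5 : k * ((k + 1) * q) < k * (n * (n - 1)) := Nat.mul_lt_mul_of_pos_left h3 (by omega)
      rw [← h2] at h5
      nlinarith
    · intro d hd hdn
      rw [Qhatd, Q_sum _ _ (fun p => X ((p.1 + p.2) % n) ω - X p.1 ω)]
      refine div_lt_aux (Nat.mul_pos (by omega) hd) hq ?_
      have h1 := circ_count hd hdn _ (by omega) hcl
      simp only [hiff]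
      set N := card _
      set k := Module.finrank ℝ W
      calc N * q ≤ k * d * q := Nat.mul_le_mul_right _ h1
        _ < k * d * n := Nat.mul_lt_mul_of_pos_left hqn (Nat.mul_pos hW1 hd)
        _ = k * (n * d) := by ring
end
end

section
/- Let X_1, ..., X_n be independent random vectors in R^q, each with a distribution assigning probability zero to every affine hyperplane of R^q. Let E be a nonempty set of two-element subsets of {1,...,n}, let V be the union of the sets in E, and let V_1, ..., V_M be the vertex sets of the maximal connected components of the graph (V, E). Set S := Σ_{m=1}^M (#V_m - 1). Then with probability one, the linear subspace W := span(X_j - X_i : {i,j} in E) of R^q has dimension dim(W) = min(S, q). -/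
open MeasureTheory ProbabilityTheory Finset
open scoped RealInnerProductSpace


theorem aux_meas {q n : ℕ} (r : Fin n → Fin n) (T : Finset (Fin n)) :
    MeasurableSet {x : Fin n → EuclideanSpace ℝ (Fin q) |
      LinearIndepOn ℝ (fun i => x i - x (r i)) (T : Set (Fin n))} := by
  have h := (isOpen_setOfPred_linearIndependent (𝕜 := ℝ) (E := EuclideanSpace ℝ (Fin q))
    (ι := (T : Set (Fin n))))
  have hc : Continuous (fun (x : Fin n → EuclideanSpace ℝ (Fin q)) (i : (T : Set (Fin n))) =>
      x i - x (r i)) := by fun_prop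
  exact (h.preimage hc).measurableSet

theorem aux_indep {q n : ℕ} {Ω : Type*} [MeasurableSpace Ω] (P : Measure Ω)
    [IsProbabilityMeasure P]
    (X : Fin n → Ω → EuclideanSpace ℝ (Fin q)) (hXm : ∀ i, Measurable (X i))
    (hindep : iIndepFun X P) (i : Fin n) :
    IndepFun (fun ω => Function.update (fun j => X j ω) i 0) (X i) P := by
  have h := hindep.indepFun_finset ({i}ᶜ : Finset (Fin n)) {i}
    (disjoint_compl_left) hXm
  let φ : ((({i}ᶜ : Finset (Fin n)) : Finset (Fin n)) → EuclideanSpace ℝ (Fin q)) →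
      (Fin n → EuclideanSpace ℝ (Fin q)) := fun y j =>
        if h : j ∈ ({i}ᶜ : Finset (Fin n)) then y ⟨j, h⟩ else 0
  let ψ : ((({i} : Finset (Fin n)) : Finset (Fin n)) → EuclideanSpace ℝ (Fin q)) →
      EuclideanSpace ℝ (Fin q) := fun y => y ⟨i, by simp⟩
  have hφ : Measurable φ := by
    refine measurable_pi_lambda _ fun j => ?_
    by_cases hj : j ∈ ({i}ᶜ : Finset (Fin n))
    · simp only [φ, hj, dif_pos]; exact measurable_pi_apply _
    · simp only [φ, hj]; exact measurable_const
  have hψ : Measurable ψ := measurable_pi_apply _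
  have h2 := h.comp hφ hψ
  convert h2 using 1
  · funext ω j
    by_cases hj : j = i
    · subst hj; simp [φ]
    · simp [φ, hj]
  · rfl

theorem aux_step {q n : ℕ} (r : Fin n → Fin n) (T : Finset (Fin n)) (i : Fin n) (hi : i ∉ T)
    (hri : r i ≠ i) (hrT : ∀ j ∈ T, r j ≠ i) (y : Fin n → EuclideanSpace ℝ (Fin q))
    (x v : EuclideanSpace ℝ (Fin q))
    (hv : ∀ w ∈ Submodule.span ℝ ((fun j => y j - y (r j)) '' (T : Set (Fin n))), ⟪v, w⟫ = 0)
    (hne : ¬ ⟪v, x⟫ = ⟪v, y (r i)⟫)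
    (h : LinearIndepOn ℝ (fun j => Function.update y i x j - Function.update y i x (r j))
      (T : Set (Fin n))) :
    LinearIndepOn ℝ (fun j => Function.update y i x j - Function.update y i x (r j))
      ((insert i T : Finset (Fin n)) : Set (Fin n)) := by
  have himg : (fun j => Function.update y i x j - Function.update y i x (r j)) ''
      (T : Set (Fin n)) = (fun j => y j - y (r j)) '' (T : Set (Fin n)) := by
    refine Set.image_congr fun j hj => ?_
    have hj' : j ∈ T := by simpa using hj
    have hji : j ≠ i := fun h => hi (h ▸ hj')
    simp only [Function.update_of_ne hji, Function.update_of_ne (hrT j hj')]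
  rw [Finset.coe_insert, linearIndepOn_insert (by simpa using hi)]
  refine ⟨h, fun hmem => hne ?_⟩
  rw [himg, Function.update_self, Function.update_of_ne hri] at hmem
  have h0 := hv _ hmem
  rwa [inner_sub_right, sub_eq_zero] at h0

theorem aux_li {q n : ℕ} {Ω : Type*} [MeasurableSpace Ω] (P : Measure Ω)
    [IsProbabilityMeasure P]
    (X : Fin n → Ω → EuclideanSpace ℝ (Fin q)) (hXm : ∀ i, Measurable (X i))
    (hindep : iIndepFun X P)
    (hplane : ∀ (i : Fin n) (v : EuclideanSpace ℝ (Fin q)) (c : ℝ), v ≠ 0 →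
      Measure.map (X i) P {x | ⟪v, x⟫ = c} = 0)
    (r : Fin n → Fin n) (T : Finset (Fin n)) : (∀ i ∈ T, r i ∉ T) → T.card ≤ q →
    ∀ᵐ ω ∂P, LinearIndepOn ℝ (fun i => X i ω - X (r i) ω) (T : Set (Fin n)) := by
  induction T using Finset.induction_on with
  | empty => intro _ _; simp
  | insert i T hi ih =>
    intro hr hcard
    rw [Finset.card_insert_of_notMem hi] at hcard
    have ih' := ih (fun j hj h => hr j (by simp [hj]) (by simp [h])) (by omega)
    have hri : r i ≠ i := fun h => hr i (by simp) (by simp [h])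
    have hrT : ∀ j ∈ T, r j ≠ i := fun j hj h => hr j (by simp [hj]) (by simp [h])
    let Z : Ω → (Fin n → EuclideanSpace ℝ (Fin q)) :=
      fun ω => Function.update (fun j => X j ω) i 0
    have hZ : Measurable Z := by
      refine measurable_pi_lambda _ fun j => ?_
      by_cases hj : j = i
      · subst hj; simp [Z]
      · simp [Z, hj, hXm j]
    let A := {x : Fin n → EuclideanSpace ℝ (Fin q) |
      LinearIndepOn ℝ (fun i => x i - x (r i)) (T : Set (Fin n))}
    let A' := {x : Fin n → EuclideanSpace ℝ (Fin q) |
      LinearIndepOn ℝ (fun i => x i - x (r i)) ((insert i T : Finset (Fin n)) : Set (Fin n))}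
    let F : (Fin n → EuclideanSpace ℝ (Fin q)) × EuclideanSpace ℝ (Fin q) →
      (Fin n → EuclideanSpace ℝ (Fin q)) := fun p => Function.update p.1 i p.2
    have hF : Measurable F := by
      refine measurable_pi_lambda _ fun j => ?_
      by_cases hj : j = i
      · subst hj; simpa [F] using measurable_snd
      · simp only [F, Function.update_of_ne hj]
        exact (measurable_pi_apply j).comp measurable_fst
    let B := F ⁻¹' (A \ A')
    have hB : MeasurableSet B := hF ((aux_meas r T).diff (aux_meas r _))
    have hmap : P.map (fun ω => (Z ω, X i ω)) = (P.map Z).prod (P.map (X i)) :=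
      (indepFun_iff_map_prod_eq_prod_map_map hZ.aemeasurable (hXm i).aemeasurable).1
        (aux_indep P X hXm hindep i)
    have : IsProbabilityMeasure (P.map (X i)) :=
      Measure.isProbabilityMeasure_map (hXm i).aemeasurable
    have : IsProbabilityMeasure (P.map Z) :=
      Measure.isProbabilityMeasure_map hZ.aemeasurable
    have hnull : ((P.map Z).prod (P.map (X i))) B = 0 := by
      rw [Measure.measure_prod_null hB]
      refine Filter.Eventually.of_forall fun y => ?_
      let W := Submodule.span ℝ ((fun j => y j - y (r j)) '' (T : Set (Fin n)))
      have hW : W ≠ ⊤ := by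
        intro h
        have h1 : Module.finrank ℝ W ≤ T.card := by
          have := finrank_span_finset_le_card (R := ℝ) (T.image (fun j => y j - y (r j)))
          rw [Finset.coe_image] at this
          exact this.trans Finset.card_image_le
        rw [h, finrank_top, finrank_euclideanSpace_fin] at h1
        omega
      have hWo : Wᗮ ≠ ⊥ := fun h => hW (Submodule.orthogonal_eq_bot_iff.1 h)
      obtain ⟨v, hv, hv0⟩ := Submodule.exists_mem_ne_zero_of_ne_bot hWo
      refine measure_mono_null ?_ (hplane i v ⟪v, y (r i)⟫ hv0)
      intro x hx
      have hx1 : F (y, x) ∈ A := hx.1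
      have hx2 : F (y, x) ∉ A' := hx.2
      by_contra hne
      refine hx2 (aux_step r T i hi hri hrT y x v ?_ hne hx1)
      intro w hw
      exact Submodule.inner_left_of_mem_orthogonal hw hv
    rw [← hmap, Measure.map_apply (hZ.prodMk (hXm i)) hB] at hnull
    have hn : ∀ᵐ ω ∂P, (Z ω, X i ω) ∉ B := measure_eq_zero_iff_ae_notMem.1 hnull
    filter_upwards [ih', hn] with ω h1 h2
    have hFω : F (Z ω, X i ω) = fun j => X j ω := by simp [F, Z]
    by_contra h3
    apply h2
    show F (Z ω, X i ω) ∈ A \ A'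
    rw [hFω]
    exact ⟨h1, h3⟩

/-- if `X_1,...,X_n` are independent random vectors in `ℝ^q` whose distributions
assign probability zero to every affine hyperplane, `E` is a nonempty edge set with maximal
connected components having vertex sets `V_1,...,V_M`, and `S := ∑_m (#V_m − 1)`, then almost
surely `dim span(X_j − X_i : {i,j} ∈ E) = min(S, q)`. -/
theorem stmt2 {q n : ℕ} {Ω : Type*} [MeasurableSpace Ω] (P : Measure Ω)
    [IsProbabilityMeasure P]
    (X : Fin n → Ω → EuclideanSpace ℝ (Fin q)) (hXm : ∀ i, Measurable (X i))
    (hindep : iIndepFun X P)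
    (hplane : ∀ (i : Fin n) (v : EuclideanSpace ℝ (Fin q)) (c : ℝ), v ≠ 0 →
      Measure.map (X i) P {x | ⟪v, x⟫ = c} = 0)
    (G : SimpleGraph (Fin n)) (hEne : G.edgeSet.Nonempty)
    {M : ℕ} (Vm : Fin M → Finset (Fin n))
    (hne : ∀ m, (Vm m).Nonempty)
    (hdisj : ∀ m m', m ≠ m' → Disjoint (Vm m) (Vm m'))
    (hunion : ∀ v : Fin n, (∃ m, v ∈ Vm m) ↔ v ∈ G.support)
    (hedge : ∀ i j : Fin n, G.Adj i j → ∃ m, i ∈ Vm m ∧ j ∈ Vm m)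
    (hconn : ∀ m, ∀ i ∈ Vm m, ∀ j ∈ Vm m, G.Reachable i j) :
    ∀ᵐ ω ∂P,
      Module.finrank ℝ
          (Submodule.span ℝ {v | ∃ i j : Fin n, G.Adj i j ∧ v = X j ω - X i ω}) =
        min (∑ m, ((Vm m).card - 1)) q := by
  classical
  choose root hroot using hne
  have huniq : ∀ m m' i, i ∈ Vm m → i ∈ Vm m' → m = m' := by
    intro m m' i h h'
    by_contra hc
    exact Finset.disjoint_left.1 (hdisj m m' hc) h h'
  let r : Fin n → Fin n := fun i => if h : ∃ m, i ∈ Vm m then root h.choose else i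
  have hr : ∀ m, ∀ i ∈ Vm m, r i = root m := by
    intro m i hi
    have h : ∃ m, i ∈ Vm m := ⟨m, hi⟩
    simp only [r, dif_pos h]
    rw [huniq _ _ i h.choose_spec hi]
  let N : Finset (Fin n) := Finset.univ.biUnion fun m => (Vm m).erase (root m)
  have hN : ∀ i, i ∈ N ↔ ∃ m, i ≠ root m ∧ i ∈ Vm m := by simp [N]
  have hNcard : N.card = ∑ m, ((Vm m).card - 1) := by
    rw [Finset.card_biUnion]
    · exact Finset.sum_congr rfl fun m _ => Finset.card_erase_of_mem (hroot m)
    · intro m _ m' _ hmm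
      exact (hdisj m m' hmm).mono (Finset.erase_subset _ _) (Finset.erase_subset _ _)
  have hrN : ∀ i ∈ N, r i ∉ N := by
    intro i hi h
    obtain ⟨m, h1, h2⟩ := (hN i).1 hi
    rw [hr m i h2] at h
    obtain ⟨m', h3, h4⟩ := (hN _).1 h
    exact h3 (by rw [huniq m m' _ (hroot m) h4])
  obtain ⟨T, hTN, hTcard⟩ := Finset.exists_subset_card_eq (min_le_left N.card q)
  have hli := aux_li P X hXm hindep hplane r T (fun i hi h => hrN i (hTN hi) (hTN h))
    (hTcard.le.trans (min_le_right _ _))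
  filter_upwards [hli] with ω hω
  rw [← hNcard]
  set W := Submodule.span ℝ {v | ∃ i j : Fin n, G.Adj i j ∧ v = X j ω - X i ω} with hW
  have hreach : ∀ i j, G.Reachable i j → X j ω - X i ω ∈ W := by
    rintro i j ⟨w⟩
    induction w with
    | nil => simp
    | cons h p ih =>
      have := W.add_mem ih (Submodule.subset_span ⟨_, _, h, rfl⟩)
      simpa using this
  have hmemW : ∀ i ∈ N, X i ω - X (r i) ω ∈ W := by
    intro i hi
    obtain ⟨m, h1, h2⟩ := (hN i).1 hi
    rw [hr m i h2]
    exact hreach _ _ (hconn m _ (hroot m) _ h2)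
  apply le_antisymm
  · refine le_min ?_ ?_
    · let W' := Submodule.span ℝ ((N.image fun i => X i ω - X (r i) ω : Finset _) :
        Set (EuclideanSpace ℝ (Fin q)))
      have hW' : ∀ m, ∀ i ∈ Vm m, X i ω - X (root m) ω ∈ W' := by
        intro m i hi
        by_cases h : i = root m
        · simp [h]
        · refine Submodule.subset_span ?_
          rw [Finset.coe_image]
          exact ⟨i, (hN i).2 ⟨m, h, hi⟩, by simp only [hr m i hi]⟩
      have hle : W ≤ W' := by
        refine Submodule.span_le.2 ?_
        rintro _ ⟨i, j, hij, rfl⟩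
        obtain ⟨m, h1, h2⟩ := hedge i j hij
        have := W'.sub_mem (hW' m j h2) (hW' m i h1)
        simpa using this
      exact (Submodule.finrank_mono hle).trans
        ((finrank_span_finset_le_card _).trans Finset.card_image_le)
    · simpa using Submodule.finrank_le W
  · let f : ↥(T : Set (Fin n)) → W := fun i => ⟨X i ω - X (r i) ω, hmemW i (hTN i.2)⟩
    have hf : LinearIndependent ℝ f := by
      apply LinearIndependent.of_comp W.subtype
      exact hω
    have := hf.fintype_card_le_finrank
    simpa [hTcard] using this
end

section
/- Fix integers n and d with 1 ≤ d ≤ (n-1)/2, and let S_d be the set of all two-element subsets {i,j} of {1,...,n} with i < j such that j - i ≤ d or j - i ≥ n - d. Let E be a set of two-element subsets of {1,...,n}, let V be the union of the sets in E, let V_1, ..., V_M be the vertex sets of the maximal connected components of the graph (V, E), and set S := Σ_{m=1}^M (#V_m - 1). If it is not the case that M = 1 and V = {1,2,...,n}, then #(E ∩ S_d) ≤ S·d. -/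
open Finset
open scoped Classical


theorem aux_boundary {n : ℕ} [NeZero n] (W : Finset (ZMod n)) (hne : W.Nonempty)
    (hW : ∃ x, x ∉ W) : ∃ a, a ∈ W ∧ a + 1 ∉ W := by
  by_contra! h
  obtain ⟨x, hx⟩ := hW
  obtain ⟨y, hy⟩ := hne
  have key : ∀ k : ℕ, y + (k : ZMod n) ∈ W := by
    intro k
    induction k with
    | zero => simpa using hy
    | succ k ih =>
      have := h _ ih
      push_cast
      rwa [← add_assoc]
  apply hx
  have := key (x - y).val
  rw [ZMod.natCast_zmod_val] at this
  simpa using this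

theorem aux_lower {n d : ℕ} [NeZero n] (hd : 1 ≤ d) (hdn : 2 * d ≤ n - 1)
    (W : Finset (ZMod n)) (a : ZMod n) (ha : a ∈ W) (ha1 : a + 1 ∉ W) :
    2 * d - 1 ≤ (((univ : Finset (ZMod n)) ×ˢ Icc 1 d).filter
      fun p => ¬ (p.1 ∈ W ↔ p.1 + (p.2 : ZMod n) ∈ W)).card := by
  have cast_inj : ∀ i j : ℕ, i < n → j < n → (i : ZMod n) = (j : ZMod n) → i = j := by
    intro i j hi hj h
    rw [ZMod.natCast_eq_natCast_iff'] at h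
    rwa [Nat.mod_eq_of_lt hi, Nat.mod_eq_of_lt hj] at h
  have h10 : (1 : ZMod n) ≠ 0 := by
    intro h
    have := cast_inj 1 0 (by omega) (by omega) (by simpa using h)
    omega
  let f1 : ℕ → ZMod n × ℕ := fun k =>
    if a + (k : ZMod n) ∈ W then (a + 1, k - 1) else (a, k)
  let f2 : ℕ → ZMod n × ℕ := fun j =>
    if (a - (j : ZMod n)) ∈ W then (a - (j : ZMod n), j + 1) else (a - (j : ZMod n), j)
  have f2fst : ∀ j, (f2 j).1 = a - (j : ZMod n) := by
    intro j; simp only [f2]; split_ifs <;> rfl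
  have i1 : ((Icc 1 d).image f1).card = d := by
    rw [card_image_of_injOn]
    · simp
    · intro x hx y hy hxy
      simp only [coe_Icc, Set.mem_Icc] at hx hy
      simp only [f1] at hxy
      split_ifs at hxy <;> simp_all
      omega
  have i2 : ((Icc 1 (d-1)).image f2).card = d - 1 := by
    rw [card_image_of_injOn]
    · simp
    · intro x hx y hy hxy
      simp only [coe_Icc, Set.mem_Icc] at hx hy
      have h := congrArg Prod.fst hxy
      rw [f2fst, f2fst] at h
      exact cast_inj x y (by omega) (by omega) (by simpa using h)
  have hdisj : Disjoint ((Icc 1 d).image f1) ((Icc 1 (d-1)).image f2) := by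
    rw [Finset.disjoint_left]
    intro p hp hq
    obtain ⟨x, hx, rfl⟩ := mem_image.1 hp
    obtain ⟨y, hy, hxy⟩ := mem_image.1 hq
    simp only [mem_Icc] at hx hy
    have h := congrArg Prod.fst hxy
    rw [f2fst] at h
    simp only [f1] at h
    split_ifs at h
    · have h2 : ((y + 1 : ℕ) : ZMod n) = ((0 : ℕ) : ZMod n) := by
        push_cast
        linear_combination -h
      have := cast_inj _ _ (by omega) (by omega) h2
      omega
    · have h2 : ((y : ℕ) : ZMod n) = ((0 : ℕ) : ZMod n) := by
        push_cast
        linear_combination -h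
      have := cast_inj _ _ (by omega) (by omega) h2
      omega
  have hcard := card_union_of_disjoint hdisj
  rw [i1, i2] at hcard
  have : 2 * d - 1 = d + (d - 1) := by omega
  rw [this, ← hcard]
  apply card_le_card
  intro p hp
  simp only [mem_filter, mem_product, mem_univ, true_and, mem_Icc]
  rcases mem_union.1 hp with hp | hp
  · obtain ⟨x, hx, rfl⟩ := mem_image.1 hp
    simp only [mem_Icc] at hx
    simp only [f1]
    split_ifs with h
    · have hx1 : x ≠ 1 := by
        rintro rfl
        exact ha1 (by simpa using h)
      refine ⟨⟨by dsimp only; omega, by dsimp only; omega⟩, ?_⟩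
      have e : a + 1 + ((x - 1 : ℕ) : ZMod n) = a + x := by
        rw [Nat.cast_sub hx.1]; push_cast; ring
      dsimp only
      rw [e]; tauto
    · exact ⟨hx, by tauto⟩
  · obtain ⟨x, hx, rfl⟩ := mem_image.1 hp
    simp only [mem_Icc] at hx
    simp only [f2]
    split_ifs with h
    · refine ⟨⟨by dsimp only; omega, by dsimp only; omega⟩, ?_⟩
      have e : a - (x : ZMod n) + ((x + 1 : ℕ) : ZMod n) = a + 1 := by
        push_cast; ring
      dsimp only
      rw [e]; tauto
    · refine ⟨⟨by dsimp only; omega, by dsimp only; omega⟩, ?_⟩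
      dsimp only
      rw [sub_add_cancel]; tauto

theorem aux_main {n d : ℕ} [NeZero n] (hd : 1 ≤ d) (hdn : 2 * d ≤ n - 1)
    (W : Finset (ZMod n)) (hne : W.Nonempty) (hW : ∃ x, x ∉ W) :
    (((univ : Finset (ZMod n)) ×ˢ Icc 1 d).filter
      fun p => p.1 ∈ W ∧ p.1 + (p.2 : ZMod n) ∈ W).card ≤ (W.card - 1) * d := by
  obtain ⟨a, ha, ha1⟩ := aux_boundary W hne hW
  have hlow := aux_lower hd hdn W a ha ha1
  set U := (univ : Finset (ZMod n)) ×ˢ Icc 1 d with hU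
  have hA : (U.filter fun p => p.1 ∈ W).card = W.card * d := by
    have : (U.filter fun p => p.1 ∈ W) = W ×ˢ Icc 1 d := by
      ext p; simp [hU]; tauto
    rw [this, card_product]; simp
  have hB : (U.filter fun p => p.1 + (p.2 : ZMod n) ∈ W).card = W.card * d := by
    rw [← hA]
    apply card_bij' (fun (p : ZMod n × ℕ) _ => (p.1 + (p.2 : ZMod n), p.2))
      (fun (p : ZMod n × ℕ) _ => (p.1 - (p.2 : ZMod n), p.2))
    all_goals simp +contextual [hU]
  have s1 := card_filter_add_card_filter_not (s := U.filter fun p => p.1 ∈ W)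
    (fun p => p.1 + (p.2 : ZMod n) ∈ W)
  have s2 := card_filter_add_card_filter_not
    (s := U.filter fun p => p.1 + (p.2 : ZMod n) ∈ W) (fun p => p.1 ∈ W)
  simp only [filter_filter] at s1 s2
  rw [hA] at s1
  rw [hB] at s2
  have e : (U.filter fun p => p.1 + (p.2 : ZMod n) ∈ W ∧ p.1 ∈ W)
      = U.filter fun p => p.1 ∈ W ∧ p.1 + (p.2 : ZMod n) ∈ W := by
    apply filter_congr; intros; tauto
  rw [e] at s2
  have hle : (U.filter fun p => ¬ (p.1 ∈ W ↔ p.1 + (p.2 : ZMod n) ∈ W)).card ≤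
      (U.filter fun p => p.1 ∈ W ∧ ¬ p.1 + (p.2 : ZMod n) ∈ W).card +
      (U.filter fun p => p.1 + (p.2 : ZMod n) ∈ W ∧ ¬ p.1 ∈ W).card := by
    refine le_trans (card_le_card ?_) (card_union_le _ _)
    intro p
    simp only [mem_union, mem_filter]
    tauto
  rw [Nat.sub_mul]
  omega

/-- if `S_d` is the circulant edge set of all pairs `{i,j}` with
`0 < j - i ≤ d` or `j - i ≥ n - d` (indices `1,...,n`, here realized as `Fin n`),
`V_1,...,V_M` are the vertex sets of the maximal connected components of `G`,
and `S := ∑_m (#V_m - 1)`, then unless `M = 1` and the vertex set is all of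
`{1,...,n}`, one has `#(E ∩ S_d) ≤ S·d`. -/
theorem stmt4 {n d : ℕ} (hd : 1 ≤ d) (hdn : 2 * d ≤ n - 1)
    (G : SimpleGraph (Fin n)) [DecidableRel G.Adj]
    {M : ℕ} (Vm : Fin M → Finset (Fin n))
    (hne : ∀ m, (Vm m).Nonempty)
    (hdisj : ∀ m m', m ≠ m' → Disjoint (Vm m) (Vm m'))
    (hunion : ∀ v : Fin n, (∃ m, v ∈ Vm m) ↔ v ∈ G.support)
    (hedge : ∀ i j : Fin n, G.Adj i j → ∃ m, i ∈ Vm m ∧ j ∈ Vm m)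
    (hconn : ∀ m, ∀ i ∈ Vm m, ∀ j ∈ Vm m, G.Reachable i j)
    (hnot : ¬ (M = 1 ∧ ∀ v : Fin n, v ∈ G.support)) :
    (G.edgeFinset.filter fun e => ∃ i j : Fin n, e = s(i, j) ∧ (i : ℕ) < (j : ℕ) ∧
        ((j : ℕ) - (i : ℕ) ≤ d ∨ (j : ℕ) - (i : ℕ) ≥ n - d)).card ≤
      (∑ m, ((Vm m).card - 1)) * d := by
  obtain ⟨m0, rfl⟩ : ∃ m0, n = m0 + 1 := ⟨n - 1, by omega⟩
  have hprop : ∀ m, ∃ x, x ∉ Vm m := by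
    intro m
    by_contra! h
    apply hnot
    refine ⟨?_, fun v => (hunion v).1 ⟨m, h v⟩⟩
    have : ∀ m', m' = m := by
      intro m'
      by_contra hne'
      obtain ⟨x, hx⟩ := hne m'
      exact Finset.disjoint_left.1 (hdisj m' m hne') hx (h x)
    have h1 : Fintype.card (Fin M) = 1 := Fintype.card_eq_one_iff.2 ⟨m, this⟩
    simpa using h1
  let P : Fin M → Finset (ZMod (m0+1) × ℕ) := fun m =>
    ((univ : Finset (ZMod (m0+1))) ×ˢ Icc 1 d).filter
      fun p => p.1 ∈ (show Finset (ZMod (m0+1)) from Vm m) ∧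
        p.1 + (p.2 : ZMod (m0+1)) ∈ (show Finset (ZMod (m0+1)) from Vm m)
  have hP : ∀ m, (P m).card ≤ ((Vm m).card - 1) * d := fun m =>
    aux_main hd hdn (show Finset (ZMod (m0+1)) from Vm m) (hne m) (hprop m)
  let F : ZMod (m0+1) × ℕ → Sym2 (Fin (m0+1)) := fun p =>
    Sym2.mk (show Fin (m0+1) from p.1) (show Fin (m0+1) from p.1 + (p.2 : ZMod (m0+1)))
  have hcast : ∀ i : Fin (m0+1), (((i : ℕ) : ZMod (m0+1))) = (show ZMod (m0+1) from i) :=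
    fun i => ZMod.natCast_zmod_val (show ZMod (m0+1) from i)
  rw [Finset.sum_mul]
  refine le_trans (card_le_card (t := univ.biUnion fun m => (P m).image F) ?_)
    (le_trans card_biUnion_le (Finset.sum_le_sum fun m _ => card_image_le.trans (hP m)))
  intro e he
  rw [mem_filter] at he
  obtain ⟨he, i, j, rfl, hij, hor⟩ := he
  have hadj : G.Adj i j := by simpa using he
  obtain ⟨m, him, hjm⟩ := hedge i j hadj
  rw [mem_biUnion]
  refine ⟨m, mem_univ _, mem_image.2 ?_⟩
  have hj := j.isLt
  rcases hor with h | h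
  · have e1 : (show ZMod (m0+1) from i) + (((j : ℕ) - (i : ℕ) : ℕ) : ZMod (m0+1))
        = (show ZMod (m0+1) from j) := by
      rw [Nat.cast_sub hij.le, hcast, hcast]; ring
    refine ⟨((show ZMod (m0+1) from i), (j : ℕ) - (i : ℕ)), ?_, ?_⟩
    · refine mem_filter.2 ⟨mem_product.2 ⟨mem_univ _, mem_Icc.2 ⟨by dsimp only; omega, by dsimp only; omega⟩⟩, him, ?_⟩
      dsimp only
      rw [e1]; exact hjm
    · simp only [F]
      rw [e1]
  · have e1 : (show ZMod (m0+1) from j) +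
        (((m0 + 1) - ((j : ℕ) - (i : ℕ)) : ℕ) : ZMod (m0+1))
        = (show ZMod (m0+1) from i) := by
      rw [Nat.cast_sub (by omega), Nat.cast_sub hij.le, hcast, hcast, ZMod.natCast_self]; ring
    refine ⟨((show ZMod (m0+1) from j), (m0 + 1) - ((j : ℕ) - (i : ℕ))), ?_, ?_⟩
    · refine mem_filter.2 ⟨mem_product.2 ⟨mem_univ _, mem_Icc.2 ⟨by dsimp only; omega, by dsimp only; omega⟩⟩, hjm, ?_⟩
      dsimp only
      rw [e1]; exact him
    · simp only [F]
      rw [e1]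
      exact Sym2.eq_swap
end

section
/- Let X_1, ..., X_n be i.i.d. random vectors in R^q, let 1 ≤ d ≤ (n-1)/2 be an integer, and let f : R^q → R^r be measurable with E‖f(X_1 - X_2)‖² < ∞. Let U_{n,d} := (nd)^{-1} Σ_{i=1}^n Σ_{j=i+1}^{i+d} f^s(X_j - X_i), with cyclic indexing X_{n+s} := X_s. Then U_{n,d} = f_0 + 2 n^{-1} Σ_{i=1}^n f_1(X_i) + M_{n,d} with M_{n,d} := (nd)^{-1} Σ_{i=1}^n Σ_{j=i+1}^{i+d} f_2(X_i, X_j), E(U_{n,d}) = f_0, and n·Var(U_{n,d}) = 4Γ_1 + n·Var(M_{n,d}) = 4Γ_1 + d^{-1} Γ_2 ≤ 2Γ in the Loewner order. -/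
open MeasureTheory ProbabilityTheory Finset
open scoped ENNReal

noncomputable section

/-- Symmetrization `f^s(x) := (f(x) + f(-x))/2`. -/
def fS {q r : ℕ} (f : EuclideanSpace ℝ (Fin q) → EuclideanSpace ℝ (Fin r))
    (x : EuclideanSpace ℝ (Fin q)) : EuclideanSpace ℝ (Fin r) :=
  (2 : ℝ)⁻¹ • (f x + f (-x))

/-- `f_0 := E f(X_1 - X_2)`. -/
def f0v {Ω : Type*} [MeasurableSpace Ω] {q r : ℕ} (P : Measure Ω)
    (X : ℕ → Ω → EuclideanSpace ℝ (Fin q))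
    (f : EuclideanSpace ℝ (Fin q) → EuclideanSpace ℝ (Fin r)) : EuclideanSpace ℝ (Fin r) :=
  ∫ ω, f (X 0 ω - X 1 ω) ∂P

/-- `f_1(x) := E f^s(x - X_1) - f_0`. -/
def f1v {Ω : Type*} [MeasurableSpace Ω] {q r : ℕ} (P : Measure Ω)
    (X : ℕ → Ω → EuclideanSpace ℝ (Fin q))
    (f : EuclideanSpace ℝ (Fin q) → EuclideanSpace ℝ (Fin r))
    (x : EuclideanSpace ℝ (Fin q)) : EuclideanSpace ℝ (Fin r) :=
  (∫ ω, fS f (x - X 0 ω) ∂P) - f0v P X f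

/-- `f_2(x,y) := f^s(x - y) - f_0 - f_1(x) - f_1(y)`. -/
def f2v {Ω : Type*} [MeasurableSpace Ω] {q r : ℕ} (P : Measure Ω)
    (X : ℕ → Ω → EuclideanSpace ℝ (Fin q))
    (f : EuclideanSpace ℝ (Fin q) → EuclideanSpace ℝ (Fin r))
    (x y : EuclideanSpace ℝ (Fin q)) : EuclideanSpace ℝ (Fin r) :=
  fS f (x - y) - f0v P X f - f1v P X f x - f1v P X f y

/-- The covariance matrix of an `ℝ^r`-valued random vector. -/
def covM {Ω : Type*} [MeasurableSpace Ω] {r : ℕ} (P : Measure Ω)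
    (Y : Ω → EuclideanSpace ℝ (Fin r)) : Matrix (Fin r) (Fin r) ℝ :=
  Matrix.of fun a b =>
    ∫ ω, (Y ω a - ∫ ω', Y ω' a ∂P) * (Y ω b - ∫ ω', Y ω' b ∂P) ∂P

/-- Loewner partial order: `A ≤ B` iff `B - A` is positive semidefinite. -/
def LoewnerLE {r : ℕ} (A B : Matrix (Fin r) (Fin r) ℝ) : Prop := (B - A).PosSemidef


/-- The balanced incomplete U-statistic
`U_{n,d} := (nd)⁻¹ ∑_{i=1}^n ∑_{j=i+1}^{i+d} f^s(X_j - X_i)` with cyclic indexing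
(indices here `0,...,n-1`). -/
def Und {Ω : Type*} {q r : ℕ} (n d : ℕ) (X : ℕ → Ω → EuclideanSpace ℝ (Fin q))
    (f : EuclideanSpace ℝ (Fin q) → EuclideanSpace ℝ (Fin r)) (ω : Ω) :
    EuclideanSpace ℝ (Fin r) :=
  ((n * d : ℕ) : ℝ)⁻¹ •
    ∑ p ∈ range n ×ˢ Icc 1 d, fS f (X ((p.1 + p.2) % n) ω - X p.1 ω)

/-- `M_{n,d} := (nd)⁻¹ ∑_{i=1}^n ∑_{j=i+1}^{i+d} f_2(X_i, X_j)` with cyclic indexing. -/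
def Mnd {Ω : Type*} [MeasurableSpace Ω] {q r : ℕ} (P : Measure Ω) (n d : ℕ)
    (X : ℕ → Ω → EuclideanSpace ℝ (Fin q))
    (f : EuclideanSpace ℝ (Fin q) → EuclideanSpace ℝ (Fin r)) (ω : Ω) :
    EuclideanSpace ℝ (Fin r) :=
  ((n * d : ℕ) : ℝ)⁻¹ •
    ∑ p ∈ range n ×ˢ Icc 1 d, f2v P X f (X p.1 ω) (X ((p.1 + p.2) % n) ω)

lemma mod_aux {n i s : ℕ} (hi : i < n) (hs : s < n) :
    (i + s) % n = if i + s < n then i + s else i + s - n := by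
  split_ifs with h
  · exact Nat.mod_eq_of_lt h
  · rw [Nat.mod_eq_sub_mod (by omega), Nat.mod_eq_of_lt (by omega)]

lemma sum_shift {M : Type*} [AddCommMonoid M] (F : ℕ → M) {n s : ℕ} (h0 : 0 < s) (hs : s < n) :
    ∑ i ∈ range n, F ((i + s) % n) = ∑ i ∈ range n, F i := by
  refine Finset.sum_nbij' (fun i => (i + s) % n) (fun i => (i + (n - s)) % n) ?_ ?_ ?_ ?_ ?_
  · intro i hi
    exact mem_range.2 (Nat.mod_lt _ (by omega))
  · intro i hi
    exact mem_range.2 (Nat.mod_lt _ (by omega))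
  · intro i hi
    have hi := mem_range.1 hi
    have hl : (i + s) % n < n := Nat.mod_lt _ (by omega)
    rw [mod_aux hl (by omega : n - s < n), mod_aux hi hs]
    split_ifs <;> omega
  · intro i hi
    have hi := mem_range.1 hi
    have hl : (i + (n - s)) % n < n := Nat.mod_lt _ (by omega)
    rw [mod_aux hl hs, mod_aux hi (by omega : n - s < n)]
    split_ifs <;> omega
  · intro i hi
    rfl

lemma idx_ne {n d i s : ℕ} (hnd : 2 * d ≤ n - 1) (hi : i < n) (h1 : 1 ≤ s) (h2 : s ≤ d) :
    i ≠ (i + s) % n := by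
  rw [mod_aux hi (by omega)]
  split_ifs <;> omega

lemma idx_inj {n d i s i' s' : ℕ} (hnd : 2 * d ≤ n - 1) (hi : i < n) (h1 : 1 ≤ s) (h2 : s ≤ d)
    (hi' : i' < n) (h1' : 1 ≤ s') (h2' : s' ≤ d) (hne : (i, s) ≠ (i', s')) :
    (i ≠ i' ∧ i ≠ (i' + s') % n) ∨ ((i + s) % n ≠ i' ∧ (i + s) % n ≠ (i' + s') % n) := by
  have hne' : ¬ (i = i' ∧ s = s') := by simpa using hne
  rw [mod_aux hi (by omega), mod_aux hi' (by omega)]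
  split_ifs <;> omega

lemma fS_neg {q r : ℕ} (f : EuclideanSpace ℝ (Fin q) → EuclideanSpace ℝ (Fin r))
    (x y : EuclideanSpace ℝ (Fin q)) : fS f (x - y) = fS f (y - x) := by
  unfold fS
  rw [neg_sub, neg_sub, add_comm]

lemma f2v_symm {Ω : Type*} [MeasurableSpace Ω] {q r : ℕ} (P : Measure Ω)
    (X : ℕ → Ω → EuclideanSpace ℝ (Fin q))
    (f : EuclideanSpace ℝ (Fin q) → EuclideanSpace ℝ (Fin r))
    (x y : EuclideanSpace ℝ (Fin q)) : f2v P X f x y = f2v P X f y x := by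
  unfold f2v
  rw [fS_neg]; abel

lemma decomp {Ω : Type*} [MeasurableSpace Ω] {q r : ℕ} (P : Measure Ω) {n d : ℕ}
    (hd : 1 ≤ d) (hnd : 2 * d ≤ n - 1)
    (X : ℕ → Ω → EuclideanSpace ℝ (Fin q))
    (f : EuclideanSpace ℝ (Fin q) → EuclideanSpace ℝ (Fin r)) (ω : Ω) :
    Und n d X f ω =
      f0v P X f + (2 : ℝ) • ((n : ℝ)⁻¹ • ∑ i ∈ range n, f1v P X f (X i ω)) +
        Mnd P n d X f ω := by
  have hn : (n : ℝ) ≠ 0 := by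
    have : 0 < n := by omega
    positivity
  have hd' : (d : ℝ) ≠ 0 := by positivity
  have e1 : ∑ p ∈ range n ×ˢ Icc 1 d, f1v P X f (X p.1 ω)
      = (d : ℝ) • ∑ i ∈ range n, f1v P X f (X i ω) := by
    rw [Finset.sum_product_right]
    simp [Nat.cast_smul_eq_nsmul]
  have e2 : ∑ p ∈ range n ×ˢ Icc 1 d, f1v P X f (X ((p.1 + p.2) % n) ω)
      = (d : ℝ) • ∑ i ∈ range n, f1v P X f (X i ω) := by
    rw [Finset.sum_product_right]
    have : ∀ s ∈ Icc 1 d, ∑ i ∈ range n, f1v P X f (X ((i + s) % n) ω)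
        = ∑ i ∈ range n, f1v P X f (X i ω) := by
      intro s hs
      rw [mem_Icc] at hs
      exact sum_shift (fun i => f1v P X f (X i ω)) (by omega) (by omega)
    rw [Finset.sum_congr rfl this]
    simp [Nat.cast_smul_eq_nsmul]
  have e3 : ∑ p ∈ range n ×ˢ Icc 1 d, f2v P X f (X p.1 ω) (X ((p.1 + p.2) % n) ω)
      = ∑ p ∈ range n ×ˢ Icc 1 d, fS f (X ((p.1 + p.2) % n) ω - X p.1 ω)
        - ((n * d : ℕ) : ℝ) • f0v P X f
        - (d : ℝ) • ∑ i ∈ range n, f1v P X f (X i ω)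
        - (d : ℝ) • ∑ i ∈ range n, f1v P X f (X i ω) := by
    nth_rw 1 [← e1]
    rw [← e2]
    unfold f2v
    simp only [Finset.sum_sub_distrib, Finset.sum_const, Nat.cast_smul_eq_nsmul]
    simp [fS_neg f (X _ ω) (X (_ % n) ω)]
  unfold Und Mnd
  rw [e3]
  push_cast
  simp only [smul_sub, smul_smul]
  have h1 : ((n:ℝ) * d)⁻¹ * (n * d) = 1 := by field_simp
  have h2 : ((n:ℝ) * d)⁻¹ * d = (n:ℝ)⁻¹ := by field_simp
  rw [h1, h2]
  module

section prob
variable {Ω : Type*} [MeasurableSpace Ω]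

lemma indep_zero {E F : Type*} [MeasurableSpace E] [MeasurableSpace F] (P : Measure Ω)
    [IsProbabilityMeasure P] {Z : Ω → F} {Y : Ω → E} (hZ : Measurable Z) (hY : Measurable Y)
    (hind : IndepFun Z Y P) (ψ : F → E → ℝ) (hψ : Measurable (Function.uncurry ψ))
    (h0 : ∀ᵐ z ∂(P.map Z), ∫ y, ψ z y ∂(P.map Y) = 0) : ∫ ω, ψ (Z ω) (Y ω) ∂P = 0 := by
  have : IsProbabilityMeasure (P.map Z) := Measure.isProbabilityMeasure_map hZ.aemeasurable
  have : IsProbabilityMeasure (P.map Y) := Measure.isProbabilityMeasure_map hY.aemeasurable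
  have e : ∫ ω, ψ (Z ω) (Y ω) ∂P
      = ∫ p, Function.uncurry ψ p ∂((P.map Z).prod (P.map Y)) := by
    rw [← hind.map_prod_eq_prod_map_map hZ.aemeasurable hY.aemeasurable,
      integral_map (hZ.prodMk hY).aemeasurable hψ.aestronglyMeasurable]
    rfl
  rw [e]
  by_cases hi : Integrable (Function.uncurry ψ) ((P.map Z).prod (P.map Y))
  · rw [integral_prod _ hi]
    exact integral_eq_zero_of_ae h0
  · exact integral_undef hi

lemma orth {E : Type*} [MeasurableSpace E] (P : Measure Ω) [IsProbabilityMeasure P]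
    (X : ℕ → Ω → E) (hXm : ∀ i, Measurable (X i)) (hindep : iIndepFun X P)
    (hident : ∀ i, Measure.map (X i) P = Measure.map (X 0) P)
    (g : E → E → ℝ) (hg : Measurable (Function.uncurry g))
    (hg0 : ∀ᵐ x ∂(P.map (X 0)), ∫ y, g x y ∂(P.map (X 0)) = 0)
    (w : E → E → ℝ) (hw : Measurable (Function.uncurry w)) {i j k l : ℕ}
    (hij : i ≠ j) (hkj : k ≠ j) (hlj : l ≠ j) :
    ∫ ω, g (X i ω) (X j ω) * w (X k ω) (X l ω) ∂P = 0 := by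
  classical
  let S : Finset ℕ := {i, k, l}
  have hd : Disjoint S {j} := by
    simp [S, hij.symm, hkj.symm, hlj.symm]
  have hI := hindep.indepFun_finset S {j} hd hXm
  let Z : Ω → (S → E) := fun ω s => X s ω
  have hZ : Measurable Z := measurable_pi_lambda _ fun s => hXm s
  have hI2 : IndepFun Z (X j) P :=
    hI.comp (φ := id) (ψ := fun y : (({j} : Finset ℕ) → E) => y ⟨j, by simp⟩) measurable_id
      (measurable_pi_apply _)
  let si : S := ⟨i, by simp [S]⟩
  let sk : S := ⟨k, by simp [S]⟩
  let sl : S := ⟨l, by simp [S]⟩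
  refine indep_zero P hZ (hXm j) hI2 (fun z y => g (z si) y * w (z sk) (z sl)) ?_ ?_
  · have m1 : Measurable (fun p : (S → E) × E => (p.1 si, p.2)) := by fun_prop
    have m2 : Measurable (fun p : (S → E) × E => (p.1 sk, p.1 sl)) := by fun_prop
    exact (hg.comp m1).mul (hw.comp m2)
  · have e : (P.map Z).map (fun z => z si) = P.map (X 0) := by
      rw [Measure.map_map (measurable_pi_apply si) hZ, ← hident i]
      rfl
    rw [← e] at hg0
    have := ae_of_ae_map (measurable_pi_apply si).aemeasurable hg0
    filter_upwards [this] with z hz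
    rw [integral_mul_const, hident j, ← e, hz, zero_mul]

lemma covM_apply {r : ℕ} (P : Measure Ω) (Y : Ω → EuclideanSpace ℝ (Fin r)) (a b : Fin r) :
    covM P Y a b = cov[fun ω => Y ω a, fun ω => Y ω b; P] := rfl

lemma covM_psd {r : ℕ} (P : Measure Ω) [IsProbabilityMeasure P]
    (Y : Ω → EuclideanSpace ℝ (Fin r)) (hY : ∀ a, MemLp (fun ω => Y ω a) 2 P) :
    (covM P Y).PosSemidef := by
  refine Matrix.PosSemidef.of_dotProduct_mulVec_nonneg ?_ ?_
  · ext a b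
    simp [covM_apply, covariance_comm]
  · intro x
    have : star x ⬝ᵥ ((covM P Y).mulVec x) = cov[fun ω => ∑ a, x a * Y ω a, fun ω => ∑ a, x a * Y ω a; P] := by
      rw [covariance_fun_sum_fun_sum (X := fun a ω => x a * Y ω a) (Y := fun a ω => x a * Y ω a)
        (fun a => (hY a).const_mul _) (fun a => (hY a).const_mul _)]
      simp only [dotProduct, Matrix.mulVec, star_trivial, Finset.mul_sum, covM_apply,
        covariance_const_mul_left, covariance_const_mul_right]
      refine Finset.sum_congr rfl fun a _ => Finset.sum_congr rfl fun b _ => ?_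
      ring
    rw [this]
    exact integral_nonneg fun ω => mul_self_nonneg _

end prob
section ana

lemma hoeff {E V : Type*} [MeasurableSpace E] [NormedAddCommGroup V] [NormedSpace ℝ V]
    [CompleteSpace V] [MeasurableSpace V] [BorelSpace V] [SecondCountableTopology V]
    (μ : Measure E) [IsProbabilityMeasure μ] (h : E → E → V)
    (hm : Measurable (Function.uncurry h)) (h2 : MemLp (Function.uncurry h) 2 (μ.prod μ))
    (c : V) (hc : c = ∫ p, Function.uncurry h p ∂(μ.prod μ)) (g1 : E → V)
    (hg1 : ∀ x, g1 x = ∫ y, h x y ∂μ - c) :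
    Measurable g1 ∧ MemLp g1 2 μ ∧ ∫ x, g1 x ∂μ = 0 ∧
      ∀ᵐ x ∂μ, Integrable (fun y => h x y - c - g1 x - g1 y) μ ∧
        ∫ y, (h x y - c - g1 x - g1 y) ∂μ = 0 := by
  have hg1' : g1 = fun x => ∫ y, h x y ∂μ - c := funext hg1
  have hint : Integrable (Function.uncurry h) (μ.prod μ) := h2.integrable (by norm_num)
  have hsm : StronglyMeasurable (fun x => ∫ y, h x y ∂μ) :=
    hm.stronglyMeasurable.integral_prod_right'
  have m1 : Measurable g1 := by
    rw [hg1']; exact hsm.measurable.sub_const c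
  have hsq : Integrable (fun p => ‖Function.uncurry h p‖ ^ 2) (μ.prod μ) :=
    (memLp_two_iff_integrable_sq_norm hm.aestronglyMeasurable).1 h2
  have l0 : MemLp (fun x => ∫ y, h x y ∂μ) 2 μ := by
    rw [memLp_two_iff_integrable_sq_norm hsm.aestronglyMeasurable]
    refine Integrable.mono hsq.integral_prod_left (hsm.norm.pow 2).aestronglyMeasurable ?_
    filter_upwards [hsq.prod_right_ae] with x hx
    have hxm : AEStronglyMeasurable (fun y => h x y) μ :=
      (hm.comp (measurable_prodMk_left (x := x))).aestronglyMeasurable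
    have hx2 : MemLp (fun y => ‖h x y‖) 2 μ :=
      ((memLp_two_iff_integrable_sq_norm hxm).2 hx).norm
    have hv := variance_nonneg (fun y => ‖h x y‖) μ
    rw [variance_eq_sub hx2] at hv
    have e1 : ‖∫ y, h x y ∂μ‖ ≤ ∫ y, ‖h x y‖ ∂μ := norm_integral_le_integral_norm _
    have e2 : ‖∫ y, h x y ∂μ‖ ^ 2 ≤ (∫ y, ‖h x y‖ ∂μ) ^ 2 := by gcongr
    have e3 : ∫ y, ‖Function.uncurry h (x, y)‖ ^ 2 ∂μ
      = ∫ y, ((fun y => ‖h x y‖) ^ 2) y ∂μ := rfl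
    rw [e3, Real.norm_of_nonneg (by positivity)]
    refine le_trans ?_ (le_abs_self _)
    linarith
  have l1 : MemLp g1 2 μ := by
    rw [hg1']; exact l0.sub (memLp_const c)
  have i1 : Integrable g1 μ := l1.integrable (by norm_num)
  have z1 : ∫ x, g1 x ∂μ = 0 := by
    rw [hg1', integral_sub (l0.integrable (by norm_num)) (integrable_const c), hc,
      integral_prod _ hint]
    simp [Function.uncurry]
  refine ⟨m1, l1, z1, ?_⟩
  filter_upwards [hint.prod_right_ae] with x hx
  have hx' : Integrable (fun y => h x y) μ := hx
  have k1 : Integrable (fun y => h x y - c) μ := hx'.sub (integrable_const c)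
  have k2 : Integrable (fun y => h x y - c - g1 x) μ := k1.sub (integrable_const _)
  refine ⟨k2.sub i1, ?_⟩
  rw [integral_sub k2 i1, integral_sub k1 (integrable_const _),
    integral_sub hx' (integrable_const c), z1, hg1 x]
  simp

variable {Ω : Type*} [MeasurableSpace Ω]

lemma law_pair {E : Type*} [MeasurableSpace E] (P : Measure Ω) [IsProbabilityMeasure P]
    (X : ℕ → Ω → E) (hXm : ∀ i, Measurable (X i)) (hindep : iIndepFun X P)
    (hident : ∀ i, Measure.map (X i) P = Measure.map (X 0) P) {i j : ℕ} (hij : i ≠ j) :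
    MeasurePreserving (fun ω => (X i ω, X j ω)) P ((P.map (X 0)).prod (P.map (X 0))) := by
  refine ⟨(hXm i).prodMk (hXm j), ?_⟩
  rw [(hindep.indepFun hij).map_prod_eq_prod_map_map (hXm i).aemeasurable (hXm j).aemeasurable,
    hident i, hident j]

/-- collected facts -/
lemma facts {q r : ℕ} (P : Measure Ω) [IsProbabilityMeasure P]
    (X : ℕ → Ω → EuclideanSpace ℝ (Fin q)) (hXm : ∀ i, Measurable (X i))
    (hindep : iIndepFun X P)
    (hident : ∀ i, Measure.map (X i) P = Measure.map (X 0) P)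
    (f : EuclideanSpace ℝ (Fin q) → EuclideanSpace ℝ (Fin r)) (hfm : Measurable f)
    (hfsq : Integrable (fun ω => ‖f (X 0 ω - X 1 ω)‖ ^ 2) P) :
    (∀ i j, i ≠ j → MemLp (fun ω => f (X i ω - X j ω)) 2 P) ∧
    (∀ i j, i ≠ j → ∫ ω, f (X i ω - X j ω) ∂P = f0v P X f) ∧
    Measurable (f1v P X f) ∧
    (∀ i, MemLp (fun ω => f1v P X f (X i ω)) 2 P) ∧
    (∫ x, f1v P X f x ∂(P.map (X 0)) = 0) ∧
    Measurable (Function.uncurry (f2v P X f)) ∧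
    (∀ i j, i ≠ j → MemLp (fun ω => f2v P X f (X i ω) (X j ω)) 2 P) ∧
    (∀ᵐ x ∂(P.map (X 0)), Integrable (fun y => f2v P X f x y) (P.map (X 0)) ∧
      ∫ y, f2v P X f x y ∂(P.map (X 0)) = 0) := by
  have hp : IsProbabilityMeasure (P.map (X 0)) :=
    Measure.isProbabilityMeasure_map (hXm 0).aemeasurable
  have hmf : Measurable (fun p : EuclideanSpace ℝ (Fin q) × EuclideanSpace ℝ (Fin q) =>
      f (p.1 - p.2)) := hfm.comp (measurable_fst.sub measurable_snd)
  have law := fun {i j : ℕ} (hij : i ≠ j) => law_pair P X hXm hindep hident hij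
  have hfS : Measurable (fS f) := by
    unfold fS
    exact (hfm.add (hfm.comp measurable_neg)).const_smul (2 : ℝ)⁻¹
  have hm : Measurable (Function.uncurry
      (fun x y : EuclideanSpace ℝ (Fin q) => fS f (x - y))) :=
    hfS.comp (measurable_fst.sub measurable_snd)
  have a0 : MemLp (fun ω => f (X 0 ω - X 1 ω)) 2 P :=
    (memLp_two_iff_integrable_sq_norm
      (hmf.comp ((hXm 0).prodMk (hXm 1))).aestronglyMeasurable).2 hfsq
  have a1 : MemLp (fun p : EuclideanSpace ℝ (Fin q) × EuclideanSpace ℝ (Fin q) =>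
      f (p.1 - p.2)) 2 ((P.map (X 0)).prod (P.map (X 0))) := by
    rw [← (law zero_ne_one).map_eq, memLp_map_measure_iff hmf.aestronglyMeasurable
      (law zero_ne_one).measurable.aemeasurable]
    exact a0
  have A : ∀ i j, i ≠ j → MemLp (fun ω => f (X i ω - X j ω)) 2 P := fun i j hij =>
    a1.comp_measurePreserving (law hij)
  have b1 : ∀ i j, i ≠ j → ∫ ω, f (X i ω - X j ω) ∂P =
      ∫ p, f (p.1 - p.2) ∂((P.map (X 0)).prod (P.map (X 0))) := by
    intro i j hij
    rw [← (law hij).map_eq, integral_map (law hij).measurable.aemeasurable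
      hmf.aestronglyMeasurable]
  have B : ∀ i j, i ≠ j → ∫ ω, f (X i ω - X j ω) ∂P = f0v P X f := by
    intro i j hij
    rw [b1 i j hij, f0v, b1 0 1 zero_ne_one]
  have s0 : MemLp (fun ω => fS f (X 0 ω - X 1 ω)) 2 P := by
    have := ((A 0 1 zero_ne_one).add (A 1 0 one_ne_zero)).const_smul (2 : ℝ)⁻¹
    refine this.ae_eq (Filter.Eventually.of_forall fun ω => ?_)
    simp [fS]
  have s1 : MemLp (Function.uncurry (fun x y : EuclideanSpace ℝ (Fin q) => fS f (x - y))) 2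
      ((P.map (X 0)).prod (P.map (X 0))) := by
    rw [← (law zero_ne_one).map_eq, memLp_map_measure_iff hm.aestronglyMeasurable
      (law zero_ne_one).measurable.aemeasurable]
    exact s0
  have c0 : f0v P X f = ∫ p, Function.uncurry
      (fun x y : EuclideanSpace ℝ (Fin q) => fS f (x - y)) p
      ∂((P.map (X 0)).prod (P.map (X 0))) := by
    rw [← (law zero_ne_one).map_eq, integral_map (law zero_ne_one).measurable.aemeasurable
      hm.aestronglyMeasurable]
    simp only [Function.uncurry, fS, neg_sub]
    rw [integral_smul, integral_add ((A 0 1 zero_ne_one).integrable (by norm_num))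
      ((A 1 0 one_ne_zero).integrable (by norm_num)), B 0 1 zero_ne_one, B 1 0 one_ne_zero]
    module
  obtain ⟨m1, l1, z1, z2⟩ := hoeff (P.map (X 0)) (fun x y => fS f (x - y)) hm s1 (f0v P X f) c0
    (f1v P X f) (by
      intro x
      rw [f1v, integral_map (hXm 0).aemeasurable]
      exact (hm.comp (measurable_prodMk_left (x := x))).aestronglyMeasurable)
  have L1 : ∀ i, MemLp (fun ω => f1v P X f (X i ω)) 2 P := fun i =>
    l1.comp_measurePreserving ⟨hXm i, hident i⟩
  refine ⟨A, B, m1, L1, z1, ?_, ?_, z2⟩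
  · exact ((hm.sub_const _).sub (m1.comp measurable_fst)).sub (m1.comp measurable_snd)
  · intro i j hij
    have := (((s1.comp_measurePreserving (law hij)).sub (memLp_const (f0v P X f))).sub
      (L1 i)).sub (L1 j)
    exact this

end ana
theorem stmt7 {q r : ℕ} {Ω : Type*} [MeasurableSpace Ω] (P : Measure Ω)
    [IsProbabilityMeasure P] {n d : ℕ} (hd : 1 ≤ d) (hnd : 2 * d ≤ n - 1)
    (X : ℕ → Ω → EuclideanSpace ℝ (Fin q)) (hXm : ∀ i, Measurable (X i))
    (hindep : iIndepFun X P)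
    (hident : ∀ i, Measure.map (X i) P = Measure.map (X 0) P)
    (f : EuclideanSpace ℝ (Fin q) → EuclideanSpace ℝ (Fin r)) (hfm : Measurable f)
    (hfsq : Integrable (fun ω => ‖f (X 0 ω - X 1 ω)‖ ^ 2) P) :
    -- Hoeffding decomposition of `U_{n,d}`
    (∀ ω, Und n d X f ω =
      f0v P X f + (2 : ℝ) • ((n : ℝ)⁻¹ • ∑ i ∈ range n, f1v P X f (X i ω)) +
        Mnd P n d X f ω) ∧
    -- `E(U_{n,d}) = f_0`
    (∫ ω, Und n d X f ω ∂P = f0v P X f) ∧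
    -- `n Var(U_{n,d}) = 4Γ_1 + n Var(M_{n,d}) = 4Γ_1 + d⁻¹ Γ_2 ≤ 2Γ`
    ((n : ℝ) • covM P (Und n d X f) =
      (4 : ℝ) • covM P (fun ω => f1v P X f (X 0 ω)) +
        (n : ℝ) • covM P (Mnd P n d X f)) ∧
    ((n : ℝ) • covM P (Mnd P n d X f) =
      ((d : ℝ))⁻¹ • covM P (fun ω => f2v P X f (X 0 ω) (X 1 ω))) ∧
    LoewnerLE ((n : ℝ) • covM P (Und n d X f))
      ((2 : ℝ) • covM P (fun ω => f (X 0 ω - X 1 ω))) := by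
  classical
  obtain ⟨A, B, m1, L1, z1, m2, L2, z2⟩ := facts P X hXm hindep hident f hfm hfsq
  have law := fun {i j : ℕ} (hij : i ≠ j) => law_pair P X hXm hindep hident hij
  have hp : IsProbabilityMeasure (P.map (X 0)) :=
    Measure.isProbabilityMeasure_map (hXm 0).aemeasurable
  have hn : (n : ℝ) ≠ 0 := by
    have : 0 < n := by omega
    positivity
  have hd' : (d : ℝ) ≠ 0 := by positivity
  -- componentwise facts
  have pm : ∀ a : Fin r, Measurable (fun v : EuclideanSpace ℝ (Fin r) => v a) := fun a =>
    (EuclideanSpace.proj (𝕜 := ℝ) a).continuous.measurable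
  have comp : ∀ (Y : Ω → EuclideanSpace ℝ (Fin r)), MemLp Y 2 P → ∀ a,
      MemLp (fun ω => Y ω a) 2 P := fun Y hY a =>
    (EuclideanSpace.proj a : EuclideanSpace ℝ (Fin r) →L[ℝ] ℝ).comp_memLp' hY
  have icomp : ∀ (F : EuclideanSpace ℝ (Fin q) → EuclideanSpace ℝ (Fin r)),
      Integrable F (P.map (X 0)) → ∫ x, F x ∂(P.map (X 0)) = 0 → ∀ a,
      ∫ x, F x a ∂(P.map (X 0)) = 0 := by
    intro F hF h0 a
    have := (EuclideanSpace.proj a : EuclideanSpace ℝ (Fin r) →L[ℝ] ℝ).integral_comp_comm hF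
    rw [h0] at this
    simpa using this
  have m1' : ∀ a, Measurable (fun x => f1v P X f x a) := fun a => (pm a).comp m1
  have m2' : ∀ a, Measurable (Function.uncurry (fun x y => f2v P X f x y a)) :=
    fun a => (pm a).comp m2
  have i1 : Integrable (f1v P X f) (P.map (X 0)) := by
    rw [integrable_map_measure m1.aestronglyMeasurable (hXm 0).aemeasurable]
    exact (L1 0).integrable (by norm_num)
  have z1' : ∀ a, ∫ x, f1v P X f x a ∂(P.map (X 0)) = 0 := icomp _ i1 z1
  have z2' : ∀ a, ∀ᵐ x ∂(P.map (X 0)), ∫ y, f2v P X f x y a ∂(P.map (X 0)) = 0 := by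
    intro a
    filter_upwards [z2] with x hx
    exact icomp _ hx.1 hx.2 a
  have L1' : ∀ a i, MemLp (fun ω => f1v P X f (X i ω) a) 2 P := fun a i => comp _ (L1 i) a
  have L2' : ∀ a i j, i ≠ j → MemLp (fun ω => f2v P X f (X i ω) (X j ω) a) 2 P :=
    fun a i j hij => comp _ (L2 i j hij) a
  have E1 : ∀ a i, ∫ ω, f1v P X f (X i ω) a ∂P = 0 := by
    intro a i
    rw [← z1' a, ← hident i, integral_map (hXm i).aemeasurable (m1' a).aestronglyMeasurable]
  have orth2 : ∀ a (w : EuclideanSpace ℝ (Fin q) → EuclideanSpace ℝ (Fin q) → ℝ),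
      Measurable (Function.uncurry w) → ∀ i j k l : ℕ, i ≠ j → k ≠ j → l ≠ j →
      ∫ ω, f2v P X f (X i ω) (X j ω) a * w (X k ω) (X l ω) ∂P = 0 := by
    intro a w hw i j k l h1 h2 h3
    exact orth P X hXm hindep hident (fun x y => f2v P X f x y a) (m2' a) (z2' a) w hw h1 h2 h3
  have E2 : ∀ a i j, i ≠ j → ∫ ω, f2v P X f (X i ω) (X j ω) a ∂P = 0 := by
    intro a i j hij
    have := orth2 a (fun _ _ => 1) measurable_const i j i i hij hij hij
    simpa using this
  have covz : ∀ Y Z : Ω → ℝ, MemLp Y 2 P → MemLp Z 2 P → ∫ ω, Y ω ∂P = 0 →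
      ∫ ω, Y ω * Z ω ∂P = 0 → cov[Y, Z; P] = 0 := by
    intro Y Z hY hZ h1 h2
    rw [covariance_eq_sub hY hZ, h1, zero_mul, sub_zero]
    exact h2
  -- covariances of the building blocks
  have C11 : ∀ a b i j, i ≠ j →
      cov[fun ω => f1v P X f (X i ω) a, fun ω => f1v P X f (X j ω) b; P] = 0 := by
    intro a b i j hij
    refine covz _ _ (L1' a i) (L1' b j) (E1 a i) ?_
    exact orth P X hXm hindep hident (fun x y => f1v P X f y a)
      ((m1' a).comp measurable_snd) (Filter.Eventually.of_forall fun x => z1' a)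
      (fun x y => f1v P X f x b) ((m1' b).comp measurable_fst) hij.symm hij.symm hij.symm
  have C11e : ∀ a b i,
      cov[fun ω => f1v P X f (X i ω) a, fun ω => f1v P X f (X i ω) b; P]
        = covM P (fun ω => f1v P X f (X 0 ω)) a b := by
    intro a b i
    rw [covM_apply, ← covariance_map_fun (X := fun x => f1v P X f x a)
      (Y := fun x => f1v P X f x b) (m1' a).aestronglyMeasurable (m1' b).aestronglyMeasurable
      (hXm i).aemeasurable, hident i, covariance_map_fun (m1' a).aestronglyMeasurable
      (m1' b).aestronglyMeasurable (hXm 0).aemeasurable]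
  have C21 : ∀ a b i j k, i ≠ j →
      cov[fun ω => f2v P X f (X i ω) (X j ω) a, fun ω => f1v P X f (X k ω) b; P] = 0 := by
    intro a b i j k hij
    refine covz _ _ (L2' a i j hij) (L1' b k) (E2 a i j hij) ?_
    by_cases hk : k = j
    · have hki : k ≠ i := by rw [hk]; exact hij.symm
      have := orth2 a (fun x y => f1v P X f x b) ((m1' b).comp measurable_fst) j i k k
        hij.symm hki hki
      simpa only [f2v_symm P X f (X j _) (X i _)] using this
    · exact orth2 a (fun x y => f1v P X f x b) ((m1' b).comp measurable_fst) i j k k hij hk hk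
  have C12 : ∀ a b i j k, i ≠ j →
      cov[fun ω => f1v P X f (X k ω) b, fun ω => f2v P X f (X i ω) (X j ω) a; P] = 0 := by
    intro a b i j k hij
    rw [covariance_comm]; exact C21 a b i j k hij
  have C22 : ∀ a b i j k l, i ≠ j → k ≠ l → ((i ≠ k ∧ i ≠ l) ∨ (j ≠ k ∧ j ≠ l)) →
      cov[fun ω => f2v P X f (X i ω) (X j ω) a, fun ω => f2v P X f (X k ω) (X l ω) b; P] = 0 := by
    intro a b i j k l hij hkl h
    refine covz _ _ (L2' a i j hij) (L2' b k l hkl) (E2 a i j hij) ?_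
    rcases h with h | h
    · have := orth2 a (fun x y => f2v P X f x y b) (m2' b) j i k l hij.symm h.1.symm h.2.symm
      simpa only [f2v_symm P X f (X j _) (X i _)] using this
    · exact orth2 a (fun x y => f2v P X f x y b) (m2' b) i j k l hij h.1.symm h.2.symm
  have exch : ∀ (F G : EuclideanSpace ℝ (Fin q) × EuclideanSpace ℝ (Fin q) → ℝ),
      Measurable F → Measurable G → ∀ i j, i ≠ j →
      cov[fun ω => F (X i ω, X j ω), fun ω => G (X i ω, X j ω); P] =
      cov[F, G; (P.map (X 0)).prod (P.map (X 0))] := by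
    intro F G hF hG i j hij
    rw [← (law hij).map_eq, covariance_map_fun hF.aestronglyMeasurable hG.aestronglyMeasurable
      (law hij).measurable.aemeasurable]
  have C22e : ∀ a b i j, i ≠ j →
      cov[fun ω => f2v P X f (X i ω) (X j ω) a, fun ω => f2v P X f (X i ω) (X j ω) b; P]
        = covM P (fun ω => f2v P X f (X 0 ω) (X 1 ω)) a b := by
    intro a b i j hij
    rw [covM_apply]
    exact (exch _ _ (m2' a) (m2' b) i j hij).trans
      (exch _ _ (m2' a) (m2' b) 0 1 zero_ne_one).symm
  -- components of `M`
  have hpn : ∀ p ∈ range n ×ˢ Icc 1 d, p.1 ≠ (p.1 + p.2) % n := by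
    intro p hp
    rw [mem_product, mem_range, mem_Icc] at hp
    exact idx_ne hnd hp.1 hp.2.1 hp.2.2
  have Ma : ∀ a, (fun ω => Mnd P n d X f ω a) = fun ω => ((n * d : ℕ) : ℝ)⁻¹ *
      ∑ p ∈ range n ×ˢ Icc 1 d, f2v P X f (X p.1 ω) (X ((p.1 + p.2) % n) ω) a := by
    intro a
    funext ω
    simp [Mnd]
  have L2p : ∀ a, ∀ p ∈ range n ×ˢ Icc 1 d,
      MemLp (fun ω => f2v P X f (X p.1 ω) (X ((p.1 + p.2) % n) ω) a) 2 P :=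
    fun a p hp => L2' a _ _ (hpn p hp)
  have L2s : ∀ a, MemLp (fun ω => ∑ p ∈ range n ×ˢ Icc 1 d,
      f2v P X f (X p.1 ω) (X ((p.1 + p.2) % n) ω) a) 2 P :=
    fun a => memLp_finsetSum _ (L2p a)
  have LM : ∀ a, MemLp (fun ω => Mnd P n d X f ω a) 2 P := by
    intro a
    rw [Ma]
    exact (L2s a).const_mul _
  have L1s : ∀ a, MemLp (fun ω => ∑ i ∈ range n, f1v P X f (X i ω) a) 2 P :=
    fun a => memLp_finsetSum _ (fun i _ => L1' a i)
  have CM : ∀ a b, cov[fun ω => Mnd P n d X f ω a, fun ω => Mnd P n d X f ω b; P]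
      = (n : ℝ)⁻¹ * ((d : ℝ)⁻¹ * covM P (fun ω => f2v P X f (X 0 ω) (X 1 ω)) a b) := by
    intro a b
    rw [Ma, Ma, covariance_const_mul_left, covariance_const_mul_right,
      covariance_fun_sum_fun_sum' (L2p a) (L2p b)]
    have : ∀ p ∈ range n ×ˢ Icc 1 d, ∑ p' ∈ range n ×ˢ Icc 1 d,
        cov[fun ω => f2v P X f (X p.1 ω) (X ((p.1 + p.2) % n) ω) a,
          fun ω => f2v P X f (X p'.1 ω) (X ((p'.1 + p'.2) % n) ω) b; P]
        = covM P (fun ω => f2v P X f (X 0 ω) (X 1 ω)) a b := by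
      intro p hp
      rw [Finset.sum_eq_single_of_mem p hp, C22e a b _ _ (hpn p hp)]
      intro p' hp' hne
      have h1 := hp
      have h2 := hp'
      rw [mem_product, mem_range, mem_Icc] at h1 h2
      exact C22 a b _ _ _ _ (hpn p hp) (hpn p' hp')
        (idx_inj hnd h1.1 h1.2.1 h1.2.2 h2.1 h2.2.1 h2.2.2 (fun h => hne h.symm))
    rw [Finset.sum_congr rfl this, Finset.sum_const, card_product, card_range, Nat.card_Icc]
    simp only [nsmul_eq_mul]
    push_cast
    field_simp
  have CS : ∀ a b, cov[fun ω => ∑ i ∈ range n, f1v P X f (X i ω) a,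
      fun ω => ∑ i ∈ range n, f1v P X f (X i ω) b; P]
      = n * covM P (fun ω => f1v P X f (X 0 ω)) a b := by
    intro a b
    rw [covariance_fun_sum_fun_sum' (fun i _ => L1' a i) (fun i _ => L1' b i)]
    have : ∀ i ∈ range n, ∑ j ∈ range n,
        cov[fun ω => f1v P X f (X i ω) a, fun ω => f1v P X f (X j ω) b; P]
        = covM P (fun ω => f1v P X f (X 0 ω)) a b := by
      intro i hi
      rw [Finset.sum_eq_single_of_mem i hi, C11e a b i]
      intro j _ hne
      exact C11 a b i j hne.symm
    rw [Finset.sum_congr rfl this]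
    simp
  have CSM : ∀ a b, cov[fun ω => ∑ i ∈ range n, f1v P X f (X i ω) a,
      fun ω => Mnd P n d X f ω b; P] = 0 := by
    intro a b
    rw [Ma, covariance_const_mul_right,
      covariance_fun_sum_fun_sum' (fun i _ => L1' a i) (L2p b)]
    rw [Finset.sum_eq_zero, mul_zero]
    intro i _
    exact Finset.sum_eq_zero fun p hp => C12 b a _ _ _ (hpn p hp)
  have CMS : ∀ a b, cov[fun ω => Mnd P n d X f ω a,
      fun ω => ∑ i ∈ range n, f1v P X f (X i ω) b; P] = 0 := by
    intro a b
    rw [covariance_comm]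
    exact CSM b a
  have hdec := decomp P hd hnd X f
  have Ua : ∀ a, (fun ω => Und n d X f ω a) = fun ω => f0v P X f a +
      ((fun ω => (2 * (n : ℝ)⁻¹) * ∑ i ∈ range n, f1v P X f (X i ω) a) +
        (fun ω => Mnd P n d X f ω a)) ω := by
    intro a
    funext ω
    rw [hdec ω]
    simp [mul_assoc, add_assoc]
  have CU : ∀ a b, cov[fun ω => Und n d X f ω a, fun ω => Und n d X f ω b; P]
      = (n : ℝ)⁻¹ * (4 * covM P (fun ω => f1v P X f (X 0 ω)) a b) +
        cov[fun ω => Mnd P n d X f ω a, fun ω => Mnd P n d X f ω b; P] := by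
    intro a b
    have l := fun a => (L1s a).const_mul (2 * (n : ℝ)⁻¹)
    have l' := fun a => (l a).add (LM a)
    rw [Ua, Ua, covariance_const_add_left ((l' a).integrable (by norm_num)),
      covariance_const_add_right ((l' b).integrable (by norm_num)),
      covariance_add_left (l a) (LM a) (l' b), covariance_add_right (l a) (l b) (LM b),
      covariance_add_right (LM a) (l b) (LM b)]
    simp only [covariance_const_mul_left, covariance_const_mul_right]
    rw [CS, CSM, CMS]
    field_simp
    ring
  have R3 : (n : ℝ) • covM P (Und n d X f) =
      (4 : ℝ) • covM P (fun ω => f1v P X f (X 0 ω)) +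
        (n : ℝ) • covM P (Mnd P n d X f) := by
    ext a b
    simp only [Matrix.smul_apply, Matrix.add_apply, smul_eq_mul]
    rw [covM_apply P (Und n d X f), covM_apply P (Mnd P n d X f), CU]
    field_simp
  have R4 : (n : ℝ) • covM P (Mnd P n d X f) =
      ((d : ℝ))⁻¹ • covM P (fun ω => f2v P X f (X 0 ω) (X 1 ω)) := by
    ext a b
    simp only [Matrix.smul_apply, smul_eq_mul]
    rw [covM_apply P (Mnd P n d X f), CM]
    field_simp
  refine ⟨hdec, ?_, R3, R4, ?_⟩
  · -- expectation
    have hS : ∀ i j, i ≠ j → Integrable (fun ω => fS f (X j ω - X i ω)) P ∧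
        ∫ ω, fS f (X j ω - X i ω) ∂P = f0v P X f := by
      intro i j hij
      have k1 := (A j i hij.symm).integrable (by norm_num : (1 : ℝ≥0∞) ≤ 2)
      have k2 := (A i j hij).integrable (by norm_num : (1 : ℝ≥0∞) ≤ 2)
      unfold fS
      simp only [neg_sub]
      refine ⟨(k1.add k2).smul (2 : ℝ)⁻¹, ?_⟩
      rw [integral_smul, integral_add k1 k2, B j i hij.symm, B i j hij]
      module
    unfold Und
    rw [integral_smul, integral_finsetSum _ (fun p hp => (hS _ _ (hpn p hp)).1),
      Finset.sum_congr rfl (fun p hp => (hS _ _ (hpn p hp)).2), Finset.sum_const, card_product,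
      card_range, Nat.card_Icc, Nat.add_sub_cancel, ← Nat.cast_smul_eq_nsmul ℝ, smul_smul,
      inv_mul_cancel₀ (by push_cast; positivity), one_smul]
  · -- Loewner bound
    let D : Ω → EuclideanSpace ℝ (Fin r) := fun ω =>
      (2 : ℝ)⁻¹ • (f (X 0 ω - X 1 ω) - f (X 1 ω - X 0 ω))
    have F1 : ∀ a, MemLp (fun ω => f (X 0 ω - X 1 ω) a) 2 P := comp _ (A 0 1 zero_ne_one)
    have F2 : ∀ a, MemLp (fun ω => f (X 1 ω - X 0 ω) a) 2 P := comp _ (A 1 0 one_ne_zero)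
    have mf : ∀ a, Measurable (fun p : EuclideanSpace ℝ (Fin q) × EuclideanSpace ℝ (Fin q) =>
        f (p.1 - p.2) a) := fun a =>
      (pm a).comp (hfm.comp (measurable_fst.sub measurable_snd))
    have mf' : ∀ a, Measurable (fun p : EuclideanSpace ℝ (Fin q) × EuclideanSpace ℝ (Fin q) =>
        f (p.2 - p.1) a) := fun a =>
      (pm a).comp (hfm.comp (measurable_snd.sub measurable_fst))
    have x1 : ∀ a b, cov[fun ω => f (X 1 ω - X 0 ω) a, fun ω => f (X 1 ω - X 0 ω) b; P]
        = cov[fun ω => f (X 0 ω - X 1 ω) a, fun ω => f (X 0 ω - X 1 ω) b; P] := fun a b =>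
      (exch _ _ (mf a) (mf b) 1 0 one_ne_zero).trans
        (exch _ _ (mf a) (mf b) 0 1 zero_ne_one).symm
    have Da : ∀ a, (fun ω => D ω a) = fun ω => (2 : ℝ)⁻¹ *
        ((fun ω => f (X 0 ω - X 1 ω) a) - (fun ω => f (X 1 ω - X 0 ω) a)) ω := by
      intro a; funext ω; simp [D]
    have Sa : ∀ a, (fun ω => fS f (X 0 ω - X 1 ω) a) = fun ω => (2 : ℝ)⁻¹ *
        ((fun ω => f (X 0 ω - X 1 ω) a) + (fun ω => f (X 1 ω - X 0 ω) a)) ω := by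
      intro a; funext ω; simp [fS, mul_add]
    have LD : ∀ a, MemLp (fun ω => D ω a) 2 P := by
      intro a
      rw [Da]
      exact ((F1 a).sub (F2 a)).const_mul _
    have K1 : ∀ a b, cov[fun ω => f (X 0 ω - X 1 ω) a, fun ω => f (X 0 ω - X 1 ω) b; P]
        = cov[fun ω => fS f (X 0 ω - X 1 ω) a, fun ω => fS f (X 0 ω - X 1 ω) b; P]
          + cov[fun ω => D ω a, fun ω => D ω b; P] := by
      intro a b
      rw [Da, Da, Sa, Sa]
      simp only [covariance_const_mul_left, covariance_const_mul_right]
      rw [covariance_add_left (F1 a) (F2 a) ((F1 b).add (F2 b)),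
        covariance_add_right (F1 a) (F1 b) (F2 b), covariance_add_right (F2 a) (F1 b) (F2 b),
        covariance_sub_left (F1 a) (F2 a) ((F1 b).sub (F2 b)),
        covariance_sub_right (F1 a) (F1 b) (F2 b), covariance_sub_right (F2 a) (F1 b) (F2 b),
        x1]
      ring
    have Sa2 : ∀ a, (fun ω => fS f (X 0 ω - X 1 ω) a) = fun ω => f0v P X f a +
        ((fun ω => f1v P X f (X 0 ω) a) + ((fun ω => f1v P X f (X 1 ω) a) +
          (fun ω => f2v P X f (X 0 ω) (X 1 ω) a))) ω := by
      intro a; funext ω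
      simp [f2v]
    have K2 : ∀ a b, cov[fun ω => fS f (X 0 ω - X 1 ω) a, fun ω => fS f (X 0 ω - X 1 ω) b; P]
        = 2 * covM P (fun ω => f1v P X f (X 0 ω)) a b
          + covM P (fun ω => f2v P X f (X 0 ω) (X 1 ω)) a b := by
      intro a b
      have u0 := fun a => L1' a 0
      have u1 := fun a => L1' a 1
      have u2 := fun a => L2' a 0 1 zero_ne_one
      have v := fun a => (u1 a).add (u2 a)
      have w := fun a => (u0 a).add (v a)
      rw [Sa2, Sa2, covariance_const_add_left ((w a).integrable (by norm_num)),
        covariance_const_add_right ((w b).integrable (by norm_num)),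
        covariance_add_left (u0 a) (v a) (w b), covariance_add_left (u1 a) (u2 a) (w b),
        covariance_add_right (u0 a) (u0 b) (v b), covariance_add_right (u0 a) (u1 b) (u2 b),
        covariance_add_right (u1 a) (u0 b) (v b), covariance_add_right (u1 a) (u1 b) (u2 b),
        covariance_add_right (u2 a) (u0 b) (v b), covariance_add_right (u2 a) (u1 b) (u2 b),
        C11e a b 0, C11e a b 1, C11 a b 0 1 zero_ne_one, C11 a b 1 0 one_ne_zero,
        C12 b a 0 1 0 zero_ne_one, C12 b a 0 1 1 zero_ne_one, C21 a b 0 1 0 zero_ne_one,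
        C21 a b 0 1 1 zero_ne_one, C22e a b 0 1 zero_ne_one]
      ring
    unfold LoewnerLE
    rw [R3, R4]
    have e : (2 : ℝ) • covM P (fun ω => f (X 0 ω - X 1 ω)) -
        ((4 : ℝ) • covM P (fun ω => f1v P X f (X 0 ω)) +
          ((d : ℝ))⁻¹ • covM P (fun ω => f2v P X f (X 0 ω) (X 1 ω)))
        = (2 : ℝ) • covM P D +
          (2 - (d : ℝ)⁻¹) • covM P (fun ω => f2v P X f (X 0 ω) (X 1 ω)) := by
      ext a b
      simp only [Matrix.smul_apply, Matrix.add_apply, Matrix.sub_apply, smul_eq_mul]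
      rw [covM_apply P (fun ω => f (X 0 ω - X 1 ω)), K1, K2, covM_apply P D]
      ring
    rw [e]
    have hd1 : (d : ℝ)⁻¹ ≤ 1 := inv_le_one_of_one_le₀ (by exact_mod_cast hd)
    exact ((covM_psd P D LD).smul (by norm_num)).add
      ((covM_psd P _ (fun a => L2' a 0 1 zero_ne_one)).smul (by linarith))
end
end

section
/- Let X_1, ..., X_n be i.i.d. random vectors in R^q with distribution P and let Q be the distribution of X_1 - X_2. Then for every bounded continuous function f : R^q → R and every integer 1 ≤ d ≤ (n-1)/2, E| ∫ f dQ̂_n - ∫ f dQ | ≤ (2/n)^{1/2} ‖f‖_∞ and E| ∫ f dQ̂_{n,d} - ∫ f dQ | ≤ (2/n)^{1/2} ‖f‖_∞, where ‖f‖_∞ is the supremum norm of f. -/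
open MeasureTheory ProbabilityTheory Finset
open scoped ENNReal RealInnerProductSpace

noncomputable section

section Helpers

variable {E Ω : Type*} [MeasurableSpace E] [MeasurableSpace Ω]
  {P : Measure Ω} [IsProbabilityMeasure P] {X : ℕ → Ω → E} {h : E → E → ℝ} {C : ℝ}

lemma aux_law (hXm : ∀ i, Measurable (X i)) (hindep : iIndepFun X P)
    (hident : ∀ i, Measure.map (X i) P = Measure.map (X 0) P)
    (σ : Fin 4 → ℕ) (hσ : Function.Injective σ) :
    Measure.map (fun ω a => X (σ a) ω) P =
      Measure.pi (fun _ : Fin 4 => Measure.map (X 0) P) := by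
  have h1 := hindep.precomp hσ
  rw [iIndepFun_iff_map_fun_eq_pi_map (fun a => (hXm _).aemeasurable)] at h1
  rw [h1]
  congr 1
  funext a
  exact hident _

lemma aux_int (hXm : ∀ i, Measurable (X i)) (hindep : iIndepFun X P)
    (hident : ∀ i, Measure.map (X i) P = Measure.map (X 0) P)
    (F : (Fin 4 → E) → ℝ) (hF : Measurable F)
    (i j k l : ℕ) (hij : i ≠ j) (hik : i ≠ k) (hil : i ≠ l) (hjk : j ≠ k) (hjl : j ≠ l)
    (hkl : k ≠ l) :
    ∫ ω, F ![X i ω, X j ω, X k ω, X l ω] ∂P = ∫ ω, F ![X 0 ω, X 1 ω, X 2 ω, X 3 ω] ∂P := by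
  have key : ∀ i j k l : ℕ, i ≠ j → i ≠ k → i ≠ l → j ≠ k → j ≠ l → k ≠ l →
      ∫ ω, F ![X i ω, X j ω, X k ω, X l ω] ∂P =
        ∫ x, F x ∂(Measure.pi (fun _ : Fin 4 => Measure.map (X 0) P)) := by
    intro i j k l hij hik hil hjk hjl hkl
    have hσ : Function.Injective ![i, j, k, l] := by
      intro a b hab
      fin_cases a <;> fin_cases b <;> simp_all
    rw [← aux_law hXm hindep hident ![i, j, k, l] hσ,
      integral_map (measurable_pi_lambda _ (fun a => hXm _)).aemeasurable
        hF.aestronglyMeasurable]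
    congr 1
    funext ω
    congr 1
    funext a
    fin_cases a <;> rfl
  rw [key i j k l hij hik hil hjk hjl hkl, key 0 1 2 3] <;> norm_num

lemma aux_integrable (hXm : ∀ i, Measurable (X i))
    (hm : Measurable (fun p : E × E => h p.1 p.2)) (hC : ∀ x y, |h x y| ≤ C) (i j k l : ℕ) :
    Integrable (fun ω => h (X i ω) (X j ω) * h (X k ω) (X l ω)) P := by
  refine Integrable.of_bound (C := C * C) ?_ ?_
  · exact ((hm.comp ((hXm i).prodMk (hXm j))).mul
      (hm.comp ((hXm k).prodMk (hXm l)))).aestronglyMeasurable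
  · refine Filter.Eventually.of_forall fun ω => ?_
    rw [Real.norm_eq_abs, abs_mul]
    exact mul_le_mul (hC _ _) (hC _ _) (abs_nonneg _) ((abs_nonneg _).trans (hC (X i ω) (X j ω)))

lemma aux_expand (hXm : ∀ i, Measurable (X i))
    (hm : Measurable (fun p : E × E => h p.1 p.2)) (hC : ∀ x y, |h x y| ≤ C)
    {ι : Type*} (S : Finset ι) (w : ι → ℝ) (s t : ι → ℕ) :
    ∫ ω, (∑ p ∈ S, w p * h (X (s p) ω) (X (t p) ω)) ^ 2 ∂P =
      ∑ p ∈ S, ∑ p' ∈ S, w p * w p' *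
        ∫ ω, h (X (s p) ω) (X (t p) ω) * h (X (s p') ω) (X (t p') ω) ∂P := by
  have hI := fun p p' => (aux_integrable (P := P) hXm hm hC (s p) (t p) (s p') (t p')).const_mul
    (w p * w p')
  have : ∀ ω, (∑ p ∈ S, w p * h (X (s p) ω) (X (t p) ω)) ^ 2 =
      ∑ p ∈ S, ∑ p' ∈ S, w p * w p' *
        (h (X (s p) ω) (X (t p) ω) * h (X (s p') ω) (X (t p') ω)) := by
    intro ω
    rw [sq, sum_mul_sum]
    refine sum_congr rfl fun p _ => sum_congr rfl fun p' _ => by ring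
  simp_rw [this]
  rw [integral_finsetSum _ (fun p _ => integrable_finsetSum _ fun p' _ => hI p p')]
  refine sum_congr rfl fun p _ => ?_
  rw [integral_finsetSum _ (fun p' _ => hI p p')]
  refine sum_congr rfl fun p' _ => ?_
  rw [integral_const_mul]

lemma aux_pair (hXm : ∀ i, Measurable (X i)) (hindep : iIndepFun X P)
    (hident : ∀ i, Measure.map (X i) P = Measure.map (X 0) P)
    (F : E → E → ℝ) (hF : Measurable (fun p : E × E => F p.1 p.2)) (i j : ℕ) (hij : i ≠ j) :
    ∫ ω, F (X i ω) (X j ω) ∂P = ∫ ω, F (X 0 ω) (X 1 ω) ∂P := by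
  have := aux_int hXm hindep hident (fun x => F (x 0) (x 1))
    (hF.comp (f := fun x : Fin 4 → E => (x 0, x 1))
      ((measurable_pi_apply 0).prodMk (measurable_pi_apply 1)))
    i j (i + j + 1) (i + j + 2) hij (by omega) (by omega) (by omega) (by omega) (by omega)
  simpa using this

lemma aux_triple (hXm : ∀ i, Measurable (X i)) (hindep : iIndepFun X P)
    (hident : ∀ i, Measure.map (X i) P = Measure.map (X 0) P)
    (hm : Measurable (fun p : E × E => h p.1 p.2)) (i j k : ℕ) (hij : i ≠ j) (hik : i ≠ k)
    (hjk : j ≠ k) :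
    ∫ ω, h (X i ω) (X j ω) * h (X i ω) (X k ω) ∂P =
      ∫ ω, h (X 0 ω) (X 1 ω) * h (X 0 ω) (X 2 ω) ∂P := by
  have := aux_int hXm hindep hident (fun x => h (x 0) (x 1) * h (x 0) (x 2))
    ((hm.comp (f := fun x : Fin 4 → E => (x 0, x 1)) ((measurable_pi_apply 0).prodMk (measurable_pi_apply 1))).mul
      (hm.comp (f := fun x : Fin 4 → E => (x 0, x 2)) ((measurable_pi_apply 0).prodMk (measurable_pi_apply 2))))
    i j k (i + j + k + 1) hij hik (by omega) hjk (by omega) (by omega)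
  simpa using this

lemma aux_disj (hXm : ∀ i, Measurable (X i)) (hindep : iIndepFun X P)
    (hident : ∀ i, Measure.map (X i) P = Measure.map (X 0) P)
    (hm : Measurable (fun p : E × E => h p.1 p.2))
    (h0 : ∫ ω, h (X 0 ω) (X 1 ω) ∂P = 0)
    (i j k l : ℕ) (hij : i ≠ j) (hik : i ≠ k) (hil : i ≠ l) (hjk : j ≠ k) (hjl : j ≠ l) :
    ∫ ω, h (X i ω) (X j ω) * h (X k ω) (X l ω) ∂P = 0 := by
  have h1 := hindep.indepFun_prodMk_prodMk hXm i j k l hik hil hjk hjl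
  have h2 := (h1.comp hm hm).integral_fun_mul_eq_mul_integral
    (hm.comp ((hXm i).prodMk (hXm j))).aestronglyMeasurable
    (hm.comp ((hXm k).prodMk (hXm l))).aestronglyMeasurable
  simp only [Function.comp_apply] at h2
  rw [h2, aux_pair hXm hindep hident h hm i j hij, h0, zero_mul]

lemma aux_two (hXm : ∀ i, Measurable (X i)) (hindep : iIndepFun X P)
    (hident : ∀ i, Measure.map (X i) P = Measure.map (X 0) P)
    (hm : Measurable (fun p : E × E => h p.1 p.2)) (hC : ∀ x y, |h x y| ≤ C)
    (hs : ∀ x y, h x y = h y x)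
    (h0 : ∫ ω, h (X 0 ω) (X 1 ω) ∂P = 0) :
    2 * ∫ ω, h (X 0 ω) (X 1 ω) * h (X 0 ω) (X 2 ω) ∂P ≤
      ∫ ω, h (X 0 ω) (X 1 ω) * h (X 0 ω) (X 1 ω) ∂P := by
  have key := aux_expand (P := P) hXm hm hC (univ : Finset (Fin 4)) ![1, -1, 1, -1]
    ![0, 1, 2, 3] ![1, 2, 3, 0]
  have hpos : 0 ≤ ∫ ω, (∑ p : Fin 4, (![1, -1, 1, -1] : Fin 4 → ℝ) p *
      h (X ((![0, 1, 2, 3] : Fin 4 → ℕ) p) ω) (X ((![1, 2, 3, 0] : Fin 4 → ℕ) p) ω)) ^ 2 ∂P :=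
    integral_nonneg fun ω => sq_nonneg _
  rw [key] at hpos
  simp only [Fin.sum_univ_four] at hpos
  simp at hpos
  have T := aux_triple (h := h) hXm hindep hident hm
  have D := aux_disj (h := h) hXm hindep hident hm h0
  have V := aux_pair hXm hindep hident (fun x y => h x y * h x y) (hm.mul hm)
  have swapL : ∀ i j k l, ∫ ω, h (X i ω) (X j ω) * h (X k ω) (X l ω) ∂P =
      ∫ ω, h (X j ω) (X i ω) * h (X k ω) (X l ω) ∂P := by
    intro i j k l; simp_rw [hs (X i _) (X j _)]
  have swapR : ∀ i j k l, ∫ ω, h (X i ω) (X j ω) * h (X k ω) (X l ω) ∂P =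
      ∫ ω, h (X i ω) (X j ω) * h (X l ω) (X k ω) ∂P := by
    intro i j k l; simp_rw [hs (X k _) (X l _)]
  rw [swapL 0 1 1 2, T 1 0 2 (by simp) (by simp) (by simp),
    D 0 1 2 3 (by simp) (by simp) (by simp) (by simp) (by simp),
    swapR 0 1 3 0, T 0 1 3 (by simp) (by simp) (by simp),
    swapR 1 2 0 1, T 1 2 0 (by simp) (by simp) (by simp),
    V 1 2 (by simp), swapL 1 2 2 3, T 2 1 3 (by simp) (by simp) (by simp),
    D 1 2 3 0 (by simp) (by simp) (by simp) (by simp) (by simp),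
    D 2 3 0 1 (by simp) (by simp) (by simp) (by simp) (by simp),
    swapR 2 3 1 2, T 2 3 1 (by simp) (by simp) (by simp), V 2 3 (by simp),
    swapL 2 3 3 0, T 3 2 0 (by simp) (by simp) (by simp),
    swapL 3 0 0 1, T 0 3 1 (by simp) (by simp) (by simp),
    D 3 0 1 2 (by simp) (by simp) (by simp) (by simp) (by simp),
    swapR 3 0 2 3, T 3 0 2 (by simp) (by simp) (by simp), V 3 0 (by simp)] at hpos
  linarith

/-- incidence -/
def aux_inc (i j a : ℕ) : ℝ := (if i = a then 1 else 0) + (if j = a then 1 else 0)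

lemma aux_M (n i j k l : ℕ) (hi : i < n) (hj : j < n) :
    ∑ a ∈ range n, aux_inc i j a * aux_inc k l a =
      (if i = k then 1 else 0) + (if i = l then 1 else 0) + (if j = k then 1 else 0) +
        (if j = l then 1 else 0) := by
  have : ∀ a, aux_inc i j a * aux_inc k l a =
      (if i = a then aux_inc k l a else 0) + (if j = a then aux_inc k l a else 0) := by
    intro a
    unfold aux_inc
    split_ifs <;> ring
  simp_rw [this, sum_add_distrib]
  rw [sum_ite_eq, sum_ite_eq, if_pos (mem_range.2 hi), if_pos (mem_range.2 hj)]
  simp only [aux_inc, eq_comm (a := k), eq_comm (a := l)]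
  ring

lemma aux_cov (hXm : ∀ i, Measurable (X i)) (hindep : iIndepFun X P)
    (hident : ∀ i, Measure.map (X i) P = Measure.map (X 0) P)
    (hm : Measurable (fun p : E × E => h p.1 p.2)) (hC : ∀ x y, |h x y| ≤ C)
    (hs : ∀ x y, h x y = h y x)
    (h0 : ∫ ω, h (X 0 ω) (X 1 ω) ∂P = 0)
    (n i j k l : ℕ) (hi : i < n) (hj : j < n) (hij : i ≠ j) (hkl : k ≠ l) :
    ∫ ω, h (X i ω) (X j ω) * h (X k ω) (X l ω) ∂P ≤
      (∫ ω, h (X 0 ω) (X 1 ω) * h (X 0 ω) (X 1 ω) ∂P) / 2 *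
        ∑ a ∈ range n, aux_inc i j a * aux_inc k l a := by
  have two := aux_two hXm hindep hident hm hC hs h0
  have T := aux_triple (h := h) hXm hindep hident hm
  have D := aux_disj (h := h) hXm hindep hident hm h0
  have V := aux_pair hXm hindep hident (fun x y => h x y * h x y) (hm.mul hm)
  have swapL : ∀ i j k l, ∫ ω, h (X i ω) (X j ω) * h (X k ω) (X l ω) ∂P =
      ∫ ω, h (X j ω) (X i ω) * h (X k ω) (X l ω) ∂P := by
    intro i j k l; simp_rw [hs (X i _) (X j _)]
  have swapR : ∀ i j k l, ∫ ω, h (X i ω) (X j ω) * h (X k ω) (X l ω) ∂P =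
      ∫ ω, h (X i ω) (X j ω) * h (X l ω) (X k ω) ∂P := by
    intro i j k l; simp_rw [hs (X k _) (X l _)]
  rw [aux_M n i j k l hi hj]
  by_cases hik : i = k
  · subst hik
    by_cases hjl : j = l
    · subst hjl
      rw [V i j hij]
      simp [hij, hij.symm]
      linarith
    · rw [T i j l hij hkl hjl]
      simp [hkl, hij.symm, hjl]
      linarith
  by_cases hil : i = l
  · subst hil
    rw [swapR]
    by_cases hjk : j = k
    · subst hjk
      rw [V i j hij]
      simp [hij, hij.symm]
      linarith
    · rw [T i j k hij hik hjk]
      simp [hik, hij.symm, hjk]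
      linarith
  by_cases hjk : j = k
  · subst hjk
    rw [swapL, T j i l hij.symm hkl hil]
    simp [hij, hil, hkl]
    linarith
  by_cases hjl : j = l
  · subst hjl
    rw [swapL, swapR, T j i k hij.symm hkl.symm hik]
    simp [hij, hik, hjk]
    linarith
  rw [D i j k l hij hik hil hjk hjl]
  simp [hik, hil, hjk, hjl]

lemma aux_main_s8 (hXm : ∀ i, Measurable (X i)) (hindep : iIndepFun X P)
    (hident : ∀ i, Measure.map (X i) P = Measure.map (X 0) P)
    (hm : Measurable (fun p : E × E => h p.1 p.2)) (hC : ∀ x y, |h x y| ≤ C)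
    (hs : ∀ x y, h x y = h y x)
    (h0 : ∫ ω, h (X 0 ω) (X 1 ω) ∂P = 0) {B : ℝ} (hB : 0 ≤ B)
    (hv : ∫ ω, h (X 0 ω) (X 1 ω) * h (X 0 ω) (X 1 ω) ∂P ≤ B ^ 2)
    {ι : Type*} (S : Finset ι) (s t : ι → ℕ) (n : ℕ) (hn : 0 < n)
    (hsn : ∀ p ∈ S, s p < n) (htn : ∀ p ∈ S, t p < n) (hst : ∀ p ∈ S, s p ≠ t p)
    (r : ℝ) (hr : 0 < r) (hdeg : ∀ a < n, ∑ p ∈ S, aux_inc (s p) (t p) a = r)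
    (N : ℝ) (hN : 2 * N = n * r) :
    ∫ ω, |∑ p ∈ S, N⁻¹ * h (X (s p) ω) (X (t p) ω)| ∂P ≤ Real.sqrt (2 / n) * B := by
  have hn' : (0 : ℝ) < n := by exact_mod_cast hn
  have hNpos : 0 < N := by nlinarith [mul_pos hn' hr]
  set v := ∫ ω, h (X 0 ω) (X 1 ω) * h (X 0 ω) (X 1 ω) ∂P with hvdef
  have hsq : ∫ ω, (∑ p ∈ S, N⁻¹ * h (X (s p) ω) (X (t p) ω)) ^ 2 ∂P ≤ 2 / n * B ^ 2 := by
    rw [aux_expand hXm hm hC S (fun _ => N⁻¹) s t]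
    calc _ ≤ ∑ p ∈ S, ∑ p' ∈ S, N⁻¹ * N⁻¹ * (v / 2 *
          ∑ a ∈ range n, aux_inc (s p) (t p) a * aux_inc (s p') (t p') a) := by
            refine sum_le_sum fun p hp => sum_le_sum fun p' hp' => ?_
            exact mul_le_mul_of_nonneg_left (aux_cov hXm hindep hident hm hC hs h0 n _ _ _ _
              (hsn p hp) (htn p hp) (hst p hp) (hst p' hp')) (by positivity)
      _ = N⁻¹ * N⁻¹ * (v / 2) * ∑ a ∈ range n, (∑ p ∈ S, aux_inc (s p) (t p) a) *
            (∑ p' ∈ S, aux_inc (s p') (t p') a) := by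
            simp_rw [sum_mul_sum, ← mul_assoc, ← mul_sum]
            congr 1
            rw [sum_comm (s := range n)]
            refine sum_congr rfl fun p _ => ?_
            rw [sum_comm]
            simp_rw [mul_sum]
      _ = N⁻¹ * N⁻¹ * (v / 2) * (n * (r * r)) := by
            congr 1
            rw [sum_congr rfl (fun a ha => by rw [hdeg a (mem_range.1 ha)])]
            simp
      _ = 2 / n * v := by
            have : N = n * r / 2 := by linarith
            rw [this]
            field_simp
      _ ≤ _ := by gcongr
  have hmeas : Measurable fun ω => ∑ p ∈ S, N⁻¹ * h (X (s p) ω) (X (t p) ω) :=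
    Finset.measurable_fun_sum _ fun p _ =>
      (hm.comp ((hXm (s p)).prodMk (hXm (t p)))).const_mul _
  have hLp : MemLp (fun ω => |∑ p ∈ S, N⁻¹ * h (X (s p) ω) (X (t p) ω)|) 2 P := by
    refine MemLp.of_bound hmeas.abs.aestronglyMeasurable (∑ p ∈ S, N⁻¹ * C)
      (Filter.Eventually.of_forall fun ω => ?_)
    rw [Real.norm_eq_abs, abs_abs]
    refine (abs_sum_le_sum_abs _ _).trans (sum_le_sum fun p _ => ?_)
    rw [abs_mul, abs_of_pos (inv_pos.2 hNpos)]
    exact mul_le_mul_of_nonneg_left (hC _ _) (by positivity)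
  have hvar := variance_nonneg (fun ω => |∑ p ∈ S, N⁻¹ * h (X (s p) ω) (X (t p) ω)|) P
  rw [variance_eq_sub hLp] at hvar
  simp only [Pi.pow_apply, sq_abs] at hvar
  refine abs_le_of_sq_le_sq' (b := Real.sqrt (2 / n) * B) ?_ (by positivity) |>.2
  rw [mul_pow, Real.sq_sqrt (by positivity)]
  linarith

end Helpers

lemma aux_symm_int {q : ℕ} (f : BoundedContinuousFunction (EuclideanSpace ℝ (Fin q)) ℝ)
    (z : EuclideanSpace ℝ (Fin q)) :
    ∫ x, f x ∂(symmDirac z) = (f z + f (-z)) / 2 := by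
  unfold symmDirac
  rw [integral_smul_measure, integral_add_measure (f.integrable _) (f.integrable _),
    integral_dirac, integral_dirac]
  simp
  ring

lemma aux_emp {q : ℕ} (f : BoundedContinuousFunction (EuclideanSpace ℝ (Fin q)) ℝ)
    {ι : Type*} (S : Finset ι) (z : ι → EuclideanSpace ℝ (Fin q)) (m : ℕ) :
    ∫ x, f x ∂((m : ℝ≥0∞)⁻¹ • ∑ p ∈ S, symmDirac (z p)) =
      ∑ p ∈ S, (m : ℝ)⁻¹ * ((f (z p) + f (-z p)) / 2) := by
  have hfin : ∀ p, Integrable f (symmDirac (z p)) := by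
    intro p
    unfold symmDirac
    exact ((f.integrable _).add_measure (f.integrable _)).smul_measure (by simp)
  rw [integral_smul_measure, integral_finsetSum_measure (fun p _ => hfin p)]
  simp [aux_symm_int, mul_sum]

lemma aux_final {q n : ℕ} (hn : 2 ≤ n)
    {Ω : Type*} [MeasurableSpace Ω] (P : Measure Ω) [IsProbabilityMeasure P]
    (X : ℕ → Ω → EuclideanSpace ℝ (Fin q)) (hXm : ∀ i, Measurable (X i))
    (hindep : iIndepFun X P)
    (hident : ∀ i, Measure.map (X i) P = Measure.map (X 0) P)
    (f : BoundedContinuousFunction (EuclideanSpace ℝ (Fin q)) ℝ)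
    {ι : Type*} (S : Finset ι) (s t : ι → ℕ)
    (hsn : ∀ p ∈ S, s p < n) (htn : ∀ p ∈ S, t p < n) (hst : ∀ p ∈ S, s p ≠ t p)
    (r : ℝ) (hr : 0 < r) (hdeg : ∀ a < n, ∑ p ∈ S, aux_inc (s p) (t p) a = r)
    (m : ℕ) (hm : #S = m) :
    ∫ ω, |(∫ x, f x ∂((m : ℝ≥0∞)⁻¹ • ∑ p ∈ S, symmDirac (X (t p) ω - X (s p) ω))) -
        ∫ x, f x ∂(Measure.map (fun ω' => X 0 ω' - X 1 ω') P)| ∂P ≤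
      Real.sqrt (2 / n) * ‖f‖ := by
  have hn0 : 0 < n := by omega
  set θ := ∫ x, f x ∂(Measure.map (fun ω' => X 0 ω' - X 1 ω') P) with hθ
  have hfm : Measurable f := f.continuous.measurable
  set g : EuclideanSpace ℝ (Fin q) → EuclideanSpace ℝ (Fin q) → ℝ :=
    fun x y => (f (y - x) + f (-(y - x))) / 2 with hg
  have hgm : Measurable (fun p : EuclideanSpace ℝ (Fin q) × EuclideanSpace ℝ (Fin q) =>
      g p.1 p.2) := by
    have h1 : Measurable (fun p : EuclideanSpace ℝ (Fin q) × EuclideanSpace ℝ (Fin q) =>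
      p.2 - p.1) := measurable_snd.sub measurable_fst
    exact ((hfm.comp h1).add (hfm.comp h1.neg)).div_const 2
  have hgb : ∀ x y, |g x y| ≤ ‖f‖ := by
    intro x y
    have h1 := abs_le.1 (f.norm_coe_le_norm (y - x))
    have h2 := abs_le.1 (f.norm_coe_le_norm (-(y - x)))
    simp only [hg]
    exact abs_le.2 ⟨by linarith [h1.1, h2.1], by linarith [h1.2, h2.2]⟩
  have hgs : ∀ x y, g x y = g y x := by
    intro x y
    simp only [hg, neg_sub]
    ring
  have hfi : ∀ i j, Integrable (fun ω => f (X i ω - X j ω)) P := by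
    intro i j
    refine Integrable.of_bound (C := ‖f‖)
      (hfm.comp ((hXm i).sub (hXm j))).aestronglyMeasurable
      (Filter.Eventually.of_forall fun ω => f.norm_coe_le_norm _)
  have hθ' : θ = ∫ ω, f (X 0 ω - X 1 ω) ∂P := by
    rw [hθ, integral_map (φ := fun ω' => X 0 ω' - X 1 ω') ((hXm 0).sub (hXm 1)).aemeasurable hfm.aestronglyMeasurable]
  have hEg : ∫ ω, g (X 0 ω) (X 1 ω) ∂P = θ := by
    simp only [hg, neg_sub]
    rw [integral_div, integral_add (hfi 1 0) (hfi 0 1), ← hθ',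
      aux_pair hXm hindep hident (fun x y => f (x - y))
        (hfm.comp (measurable_fst.sub measurable_snd)) 1 0 (by simp), ← hθ']
    ring
  have hgi : Integrable (fun ω => g (X 0 ω) (X 1 ω)) P :=
    Integrable.of_bound (C := ‖f‖) (hgm.comp ((hXm 0).prodMk (hXm 1))).aestronglyMeasurable
      (Filter.Eventually.of_forall fun ω => hgb _ _)
  have hgLp : MemLp (fun ω => g (X 0 ω) (X 1 ω)) 2 P :=
    MemLp.of_bound (hgm.comp ((hXm 0).prodMk (hXm 1))).aestronglyMeasurable ‖f‖
      (Filter.Eventually.of_forall fun ω => hgb _ _)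
  have hcount : 2 * (m : ℝ) = n * r := by
    have h1 : ∑ a ∈ range n, ∑ p ∈ S, aux_inc (s p) (t p) a = n * r := by
      rw [sum_congr rfl (fun a ha => hdeg a (mem_range.1 ha))]
      simp
    rw [sum_comm] at h1
    rw [← h1, ← hm, sum_congr rfl (g := fun _ => (2 : ℝ))]
    · simp [mul_comm]
    · intro p hp
      simp only [aux_inc, sum_add_distrib]
      rw [sum_ite_eq, sum_ite_eq, if_pos (mem_range.2 (hsn p hp)),
        if_pos (mem_range.2 (htn p hp))]
      norm_num
  have hmpos : (0 : ℝ) < m := by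
    have : (0 : ℝ) < n := by exact_mod_cast hn0
    nlinarith [mul_pos this hr]
  have main := aux_main_s8 (h := fun x y => g x y - θ) (C := ‖f‖ + |θ|) hXm hindep hident
    (hgm.sub_const θ) (fun x y => (abs_sub _ _).trans (by linarith [hgb x y]))
    (fun x y => by rw [hgs]) (by rw [integral_sub hgi (integrable_const _), hEg]; simp)
    (norm_nonneg f) ?_ S s t n hn0 hsn htn hst r hr hdeg m hcount
  · refine le_trans (le_of_eq ?_) main
    congr 1
    funext ω
    congr 1
    rw [aux_emp]
    simp only [mul_sub, sum_sub_distrib, sum_const, hm, nsmul_eq_mul]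
    rw [mul_inv_cancel_left₀ hmpos.ne']
  · have h1 := variance_le_expectation_sq
      (hgm.comp ((hXm 0).prodMk (hXm 1))).aestronglyMeasurable (μ := P)
    rw [variance_eq_integral
      (hgm.comp ((hXm 0).prodMk (hXm 1))).aemeasurable] at h1
    simp only [Function.comp_apply, hEg, Pi.pow_apply] at h1
    simp_rw [← sq]
    refine h1.trans ?_
    calc _ ≤ ∫ ω, ‖f‖ ^ 2 ∂P := by
          refine integral_mono hgLp.integrable_sq (integrable_const _) fun ω => ?_
          exact sq_le_sq' (abs_le.1 (hgb _ _)).1 (abs_le.1 (hgb _ _)).2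
      _ = _ := by simp

lemma aux_deg1 (n : ℕ) (a : ℕ) (ha : a < n) :
    ∑ p ∈ (range n ×ˢ range n).filter (fun p => p.1 < p.2), aux_inc p.1 p.2 a = (n : ℝ) - 1 := by
  rw [sum_filter, sum_product]
  have h1 : ∀ i j : ℕ, (if i < j then aux_inc i j a else 0) =
      (if i = a then (if a < j then (1 : ℝ) else 0) else 0) +
        (if j = a then (if i < a then (1 : ℝ) else 0) else 0) := by
    intro i j
    unfold aux_inc
    split_ifs <;> first | omega | simp
  simp_rw [h1, sum_add_distrib]
  rw [sum_comm]
  simp only [sum_ite_eq', mem_range, ha, if_true]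
  rw [← sum_add_distrib]
  have h2 : ∀ x : ℕ, ((if a < x then (1 : ℝ) else 0) + if x < a then 1 else 0) =
      1 - if x = a then 1 else 0 := by
    intro x
    split_ifs <;> first | omega | simp
  simp_rw [h2, sum_sub_distrib]
  simp [ha]

lemma aux_card1 (n : ℕ) :
    #((range n ×ˢ range n).filter (fun p => p.1 < p.2)) = n.choose 2 := by
  rcases Nat.eq_zero_or_pos n with rfl | hn
  · simp
  have h1 : ∑ a ∈ range n, ∑ p ∈ (range n ×ˢ range n).filter (fun p => p.1 < p.2),
      aux_inc p.1 p.2 a = n * ((n : ℝ) - 1) := by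
    rw [sum_congr rfl (fun a ha => aux_deg1 n a (mem_range.1 ha))]
    simp
    ring
  rw [sum_comm, sum_congr rfl (g := fun _ => (2 : ℝ))] at h1
  · have h2 := Nat.cast_choose_two ℝ n
    simp only [sum_const, nsmul_eq_mul] at h1
    have : ((#((range n ×ˢ range n).filter (fun p => p.1 < p.2)) : ℕ) : ℝ) =
      (n.choose 2 : ℕ) := by rw [h2]; linarith
    exact_mod_cast this
  · intro p hp
    simp only [mem_filter, mem_product, mem_range] at hp
    simp only [aux_inc, sum_add_distrib]
    rw [sum_ite_eq, sum_ite_eq, if_pos (mem_range.2 hp.1.1), if_pos (mem_range.2 hp.1.2)]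
    norm_num

lemma aux_deg2 (n d : ℕ) (hd : d < n) (a : ℕ) (ha : a < n) :
    ∑ p ∈ range n ×ˢ Icc 1 d, aux_inc p.1 ((p.1 + p.2) % n) a = 2 * (d : ℝ) := by
  unfold aux_inc
  rw [sum_add_distrib, sum_product, sum_product, sum_comm, sum_comm (s := range n)]
  have h1 : ∀ k ∈ Icc 1 d, ∑ i ∈ range n, (if (i + k) % n = a then (1 : ℝ) else 0) = 1 := by
    intro k hk
    rw [mem_Icc] at hk
    have h2 : ∀ i ∈ range n, (if (i + k) % n = a then (1 : ℝ) else 0) =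
        if i = (if k ≤ a then a - k else a + n - k) then 1 else 0 := by
      intro i hi
      rw [mem_range] at hi
      congr 1
      rcases lt_or_ge (i + k) n with h1 | h1
      · rw [Nat.mod_eq_of_lt h1]
        split_ifs <;> apply propext <;> omega
      · rw [Nat.mod_eq_sub_mod h1, Nat.mod_eq_of_lt (by omega)]
        split_ifs <;> apply propext <;> omega
    rw [sum_congr rfl h2, sum_ite_eq', if_pos]
    rw [mem_range]
    split_ifs <;> omega
  rw [sum_congr rfl h1]
  simp [ha]
  ring

/-- `E|∫ f dQ̂_n − ∫ f dQ| ≤ √(2/n) ‖f‖_∞` and likewise for `Q̂_{n,d}`,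
for every bounded continuous `f` and `1 ≤ d ≤ (n-1)/2`, where `Q = L(X_1 - X_2)`. -/
theorem stmt8 {q n : ℕ} (hn : 2 ≤ n)
    {Ω : Type*} [MeasurableSpace Ω] (P : Measure Ω) [IsProbabilityMeasure P]
    (X : ℕ → Ω → EuclideanSpace ℝ (Fin q)) (hXm : ∀ i, Measurable (X i))
    (hindep : iIndepFun X P)
    (hident : ∀ i, Measure.map (X i) P = Measure.map (X 0) P)
    (f : BoundedContinuousFunction (EuclideanSpace ℝ (Fin q)) ℝ) :
    (∫ ω, |(∫ x, f x ∂(Qhat n X ω)) -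
        ∫ x, f x ∂(Measure.map (fun ω' => X 0 ω' - X 1 ω') P)| ∂P ≤
      Real.sqrt (2 / n) * ‖f‖) ∧
    ∀ d : ℕ, 1 ≤ d → 2 * d ≤ n - 1 →
      ∫ ω, |(∫ x, f x ∂(Qhatd n d X ω)) -
          ∫ x, f x ∂(Measure.map (fun ω' => X 0 ω' - X 1 ω') P)| ∂P ≤
        Real.sqrt (2 / n) * ‖f‖ := by
  refine ⟨?_, ?_⟩
  · refine aux_final hn P X hXm hindep hident f
      ((range n ×ˢ range n).filter fun p => p.1 < p.2) (fun p => p.1) (fun p => p.2)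
      ?_ ?_ ?_ ((n : ℝ) - 1) ?_ ?_ (n.choose 2) ?_
    · intro p hp; simp at hp; omega
    · intro p hp; simp at hp; omega
    · intro p hp; simp at hp; omega
    · have : (2 : ℝ) ≤ n := by exact_mod_cast hn
      linarith
    · exact aux_deg1 n
    · exact aux_card1 n
  · intro d hd hdn
    refine aux_final hn P X hXm hindep hident f
      (range n ×ˢ Icc 1 d) (fun p => p.1) (fun p => (p.1 + p.2) % n)
      ?_ ?_ ?_ (2 * (d : ℝ)) ?_ ?_ (n * d) ?_
    · intro p hp; simp at hp; omega
    · intro p hp; exact Nat.mod_lt _ (by omega)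
    · intro p hp h
      simp only [mem_product, mem_range, mem_Icc] at hp
      rcases lt_or_ge (p.1 + p.2) n with h1 | h1
      · rw [Nat.mod_eq_of_lt h1] at h; omega
      · rw [Nat.mod_eq_sub_mod h1, Nat.mod_eq_of_lt (by omega)] at h; omega
    · have : (1 : ℝ) ≤ d := by exact_mod_cast hd
      linarith
    · exact aux_deg2 n d (by omega)
    · simp
end
end
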